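/- arXiv:0706.3028 — 2 statements merged into one kernel-verified Lean document; each statement's English description precedes it below -/
import Mathlib

section
/- Let R be a Noetherian regular local ring of prime characteristic p > 0, let N be an Artinian R-module, let t ≥ 1 be an integer, and let φ : N → N be an action of the t-fold Frobenius, i.e. a morphism of abelian groups such that φ(r·n) = r^{p^t}·φ(n) for all r ∈ R and n ∈ N. Let M = { n ∈ N : φ^s(n) = 0 for some integer s ≥ 1 } be the set of elements of N nilpotent under φ. Then there exists an integer s ≥ 1 such that φ^s(n) = 0 for all n ∈ M. -/
/-- The `q`-th bracket power of an ideal: the ideal generated by the `q`-th powers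
of the elements of `J`. -/
def bracketPow {R : Type*} [CommRing R] (J : Ideal R) (q : ℕ) : Ideal R :=
  Ideal.span ((fun x => x ^ q) '' (J : Set R))

/-- `Ie p a e` is the intersection of all ideals `I` with `a ⊆ I^{[p^e]}`. -/
def Ie {R : Type*} [CommRing R] (p : ℕ) (a : Ideal R) (e : ℕ) : Ideal R :=
  sInf {I : Ideal R | a ≤ bracketPow I (p ^ e)}

/-- Condition (*): `a ⊆ I_e(a)^{[p^e]}` for every ideal `a` and every `e ≥ 1`. -/
def CondStar (R : Type*) [CommRing R] (p : ℕ) : Prop :=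
  ∀ (a : Ideal R) (e : ℕ), 1 ≤ e → a ≤ bracketPow (Ie p a e) (p ^ e)

/-- The generalized test ideal `τ(a^c)`: the supremum, in the lattice of ideals of `R`,
of the ideals `I_e(a^{⌈c p^e⌉})` for `e ≥ 1`. -/
noncomputable def tau {R : Type*} [CommRing R] (p : ℕ) (a : Ideal R) (c : ℝ) : Ideal R :=
  ⨆ e : {e : ℕ // 1 ≤ e}, Ie p (a ^ ⌈c * (p : ℝ) ^ (e : ℕ)⌉₊) (e : ℕ)

/-- `c > 0` is an F-jumping coefficient of `a` if `τ(a^c) ≠ τ(a^{c-ε})` for all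
`0 < ε < c`. -/
def IsFJumpingCoeff {R : Type*} [CommRing R] (p : ℕ) (a : Ideal R) (c : ℝ) : Prop :=
  0 < c ∧ ∀ ε : ℝ, 0 < ε → ε < c → tau p a c ≠ tau p a (c - ε)

/-- `x` is an accumulation point of `S ⊆ ℝ`. -/
def IsAccumulationPt (S : Set ℝ) (x : ℝ) : Prop :=
  ∀ ε : ℝ, 0 < ε → ∃ y ∈ S, y ≠ x ∧ |y - x| < ε

/-- `R` is a regular local ring: Noetherian, local, and the maximal ideal is generated
by `dim R` elements. -/
def IsRegularStmt (R : Type*) [CommRing R] [IsLocalRing R] : Prop :=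
  ∃ s : Finset R, IsLocalRing.maximalIdeal R = Ideal.span (s : Set R) ∧
    (s.card : WithBot (WithTop ℕ)) = ringKrullDim R

namespace HSL
open IsLocalRing

/-- The socle of `U` is at most one-dimensional. -/
def SimpleSocle (R : Type*) [CommRing R] [IsLocalRing R] (U : Type*) [AddCommGroup U]
    [Module R U] : Prop :=
  ∀ x y : U, (∀ r ∈ maximalIdeal R, r • x = 0) → x ≠ 0 →
    (∀ r ∈ maximalIdeal R, r • y = 0) → ∃ r : R, y = r • x

section
variable {R : Type*} [CommRing R] [IsNoetherianRing R] [IsLocalRing R]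
variable {U : Type*} [AddCommGroup U] [Module R U]

theorem exists_sub (L : Submodule R U) (hL : L.FG) (h : L ≠ ⊥) :
    ∃ L' : Submodule R U, L' < L ∧ ∃ l ∈ L, (∀ x ∈ L, ∃ y ∈ L', ∃ r : R, x = y + r • l) ∧
      ∀ r ∈ maximalIdeal R, r • l ∈ L' := by
  have : Module.Finite R L := Module.Finite.iff_fg.mpr hL
  have hnt : (⊥ : Submodule R L) ≠ ⊤ := by
    intro h'
    apply h
    rw [eq_bot_iff]
    intro x hx
    have : (⟨x, hx⟩ : L) ∈ (⊥ : Submodule R L) := h' ▸ Submodule.mem_top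
    simpa using this
  obtain ⟨C, hC, -⟩ := (eq_top_or_exists_le_coatom (⊥ : Submodule R L)).resolve_left hnt
  obtain ⟨l, hl⟩ : ∃ l : L, l ∉ C := by
    by_contra! hh
    exact hC.1 (eq_top_iff.mpr fun x _ => hh x)
  have key : ∀ z : L, z ∉ C → ∀ x : L, ∃ y ∈ C, ∃ r : R, x = y + r • z := by
    intro z hz x
    have h1 : C ⊔ Submodule.span R {z} = ⊤ := by
      apply hC.2
      refine lt_of_le_of_ne le_sup_left fun hh => hz ?_
      rw [hh]
      exact Submodule.mem_sup_right (Submodule.mem_span_singleton_self z)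
    have h2 : x ∈ C ⊔ Submodule.span R {z} := h1 ▸ Submodule.mem_top
    obtain ⟨y, hy, w, hw, rfl⟩ := Submodule.mem_sup.mp h2
    obtain ⟨r, rfl⟩ := Submodule.mem_span_singleton.mp hw
    exact ⟨y, hy, r, rfl⟩
  refine ⟨C.map L.subtype, ?_, l, l.2, ?_, ?_⟩
  · refine lt_of_le_of_ne (Submodule.map_subtype_le _ _) fun hh => hl ?_
    have h6 : (l : U) ∈ C.map L.subtype := hh.ge l.2
    simpa using h6
  · intro x hx
    obtain ⟨y, hy, r, hr⟩ := key l hl ⟨x, hx⟩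
    exact ⟨y, ⟨y, hy, rfl⟩, r, by simpa using congrArg Subtype.val hr⟩
  · intro r hr
    refine ⟨r • l, ?_, rfl⟩
    by_contra hn
    obtain ⟨y, hy, t, ht⟩ := key _ hn l
    have hu : IsUnit (1 - t * r) := by
      by_contra h'
      have h3 : (1 - t * r) ∈ maximalIdeal R := (mem_maximalIdeal _).mpr h'
      have h4 := Ideal.add_mem _ h3 (Ideal.mul_mem_left _ t hr)
      simp only [sub_add_cancel] at h4
      exact (Ideal.ne_top_iff_one _).mp (maximalIdeal.isMaximal R).ne_top h4
    have h5 : (1 - t * r) • l ∈ C := by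
      have : (1 - t * r) • l = y := by
        rw [sub_smul, one_smul, mul_smul, sub_eq_iff_eq_add]; exact ht
      rwa [this]
    obtain ⟨u, hu⟩ := hu
    apply hl
    have := C.smul_mem (↑u⁻¹ : R) h5
    rwa [← hu, smul_smul, Units.inv_mul, one_smul] at this

theorem double_ann_fg [IsArtinian R U] (hU : SimpleSocle R U) (L : Submodule R U) :
    L.FG → ∀ e : U, (∀ r : R, (∀ x ∈ L, r • x = 0) → r • e = 0) → e ∈ L := by
  induction L using WellFoundedLT.induction with
  | _ L ih =>
  intro hfg e he
  by_cases hb : L = ⊥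
  · subst hb
    have := he 1 (by simp)
    simpa using this
  obtain ⟨L', hlt, l, hl, hspan, hm⟩ := exists_sub L hfg hb
  have hfg' : L'.FG := by
    have : IsNoetherian R L := isNoetherian_of_fg_of_noetherian L hfg
    exact (isNoetherian_submodule.mp this) L' hlt.le
  by_cases hA : ∀ r : R, (∀ x ∈ L', r • x = 0) → ∀ x ∈ L, r • x = 0
  · exact hlt.le (ih L' hlt hfg' e fun r hr => he r (hA r hr))
  push Not at hA
  obtain ⟨a, ha, x, hx, hax⟩ := hA
  have kill : ∀ b : R, (∀ x ∈ L', b • x = 0) → b • l = 0 → b • e = 0 := by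
    intro b hb1 hb2
    apply he
    intro x hx
    obtain ⟨y, hy, r, rfl⟩ := hspan x hx
    rw [smul_add, hb1 y hy, smul_comm, hb2, smul_zero, add_zero]
  have hal : a • l ≠ 0 := by
    intro h0
    obtain ⟨y, hy, r, rfl⟩ := hspan x hx
    apply hax
    rw [smul_add, ha y hy, smul_comm, h0, smul_zero, add_zero]
  have soc : ∀ b : R, (∀ x ∈ L', b • x = 0) → ∀ r ∈ maximalIdeal R, r • b • l = 0 := by
    intro b hb r hr
    rw [smul_comm]
    exact hb _ (hm r hr)
  obtain ⟨r, hr⟩ := hU (a • l) (a • e) (soc a ha) hal (by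
    intro r hr
    rw [smul_smul]
    apply kill
    · intro x hx
      rw [mul_smul, ha x hx, smul_zero]
    · rw [mul_smul]
      exact soc a ha r hr)
  have h1 : e - r • l ∈ L' := by
    apply ih L' hlt hfg'
    intro b hb
    obtain ⟨c, hc⟩ := hU (a • l) (b • l) (soc a ha) hal (soc b hb)
    have h2 : (b - c * a) • e = 0 := by
      apply kill
      · intro x hx
        rw [sub_smul, mul_smul, ha x hx, hb x hx, smul_zero, sub_zero]
      · rw [sub_smul, mul_smul, hc, sub_self]
    rw [sub_smul, mul_smul, hr, sub_eq_zero] at h2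
    rw [smul_sub, h2, smul_comm b r l, hc, smul_comm c r, sub_self]
  have := L.add_mem (hlt.le h1) (L.smul_mem r hl)
  simpa using this

theorem torsion [IsArtinian R U] (e : U) :
    ∃ k : ℕ, ∀ r ∈ maximalIdeal R ^ k, r • e = 0 := by
  let f : ℕ →o (Submodule R U)ᵒᵈ :=
    ⟨fun k => OrderDual.toDual ((maximalIdeal R ^ k) • Submodule.span R {e}), fun i j hij =>
      OrderDual.toDual_le_toDual.mpr (Submodule.smul_mono_left (Ideal.pow_le_pow_right hij))⟩
  obtain ⟨n, hn⟩ := IsArtinian.monotone_stabilizes f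
  have h1 : (maximalIdeal R ^ n) • Submodule.span R {e} =
      (maximalIdeal R ^ (n+1)) • Submodule.span R {e} := hn (n+1) (Nat.le_succ n)
  have h2 : (maximalIdeal R ^ n) • Submodule.span R {e} = ⊥ := by
    apply Submodule.eq_bot_of_le_smul_of_le_jacobson_bot (maximalIdeal R)
    · exact Submodule.FG.smul (Ideal.fg_of_isNoetherianRing _) (Submodule.fg_span_singleton e)
    · conv_lhs => rw [h1]
      rw [pow_succ', mul_smul]
    · rw [jacobson_eq_maximalIdeal _ bot_ne_top]
  refine ⟨n, fun r hr => ?_⟩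
  have : r • e ∈ (maximalIdeal R ^ n) • Submodule.span R {e} :=
    Submodule.smul_mem_smul hr (Submodule.mem_span_singleton_self e)
  rwa [h2, Submodule.mem_bot] at this

theorem artinian_quot_pow (k : ℕ) : IsArtinianRing (R ⧸ maximalIdeal R ^ k) := by
  rcases Nat.eq_zero_or_pos k with rfl | hk
  · have : Subsingleton (R ⧸ maximalIdeal R ^ 0) :=
      Ideal.Quotient.subsingleton_iff.mpr (by simp)
    infer_instance
  apply IsLocalRing.quotient_artinian_of_mem_minimalPrimes_of_isLocalRing
  refine ⟨⟨(maximalIdeal.isMaximal R).isPrime, Ideal.pow_le_self hk.ne'⟩, ?_⟩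
  rintro J ⟨hJ, hle⟩ -
  exact hJ.le_of_pow_le hle

theorem fg_of_torsion [IsArtinian R U] (k : ℕ) (L : Submodule R U)
    (hL : ∀ r ∈ maximalIdeal R ^ k, ∀ x ∈ L, r • x = 0) : L.FG := by
  have ht : Module.IsTorsionBySet R L (maximalIdeal R ^ k : Ideal R) := by
    rintro x ⟨r, hr⟩
    exact Subtype.ext (hL r hr x x.2)
  letI : Module (R ⧸ maximalIdeal R ^ k) L := ht.module
  haveI : IsScalarTower R (R ⧸ maximalIdeal R ^ k) L := ht.isScalarTower
  have h1 : IsArtinian (R ⧸ maximalIdeal R ^ k) L := isArtinian_of_tower R inferInstance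
  have h2 := artinian_quot_pow (R := R) k
  have h3 : IsNoetherian (R ⧸ maximalIdeal R ^ k) L :=
    IsSemiprimaryRing.isNoetherian_iff_isArtinian.mpr h1
  have h4 : Module.Finite R L := Module.Finite.trans (R ⧸ maximalIdeal R ^ k) L
  exact Module.Finite.iff_fg.mp h4

theorem stab_mod (I : ℕ → Ideal R) (hI : Antitone I) (j : ℕ) :
    ∃ n, ∀ k, n ≤ k → I n ≤ I k ⊔ maximalIdeal R ^ j := by
  have h2 := artinian_quot_pow (R := R) j
  let f : ℕ →o (Ideal (R ⧸ maximalIdeal R ^ j))ᵒᵈ :=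
    ⟨fun k => OrderDual.toDual ((I k).map (Ideal.Quotient.mk _)), fun a b hab =>
      OrderDual.toDual_le_toDual.mpr (Ideal.map_mono (hI hab))⟩
  obtain ⟨n, hn⟩ := IsArtinian.monotone_stabilizes f
  refine ⟨n, fun k hk x hx => ?_⟩
  have h1 : (I n).map (Ideal.Quotient.mk (maximalIdeal R ^ j)) =
    (I k).map (Ideal.Quotient.mk _) := hn k hk
  have h3 : Ideal.Quotient.mk (maximalIdeal R ^ j) x ∈
      (I k).map (Ideal.Quotient.mk _) := h1 ▸ Ideal.mem_map_of_mem _ hx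
  obtain ⟨y, hy, hyx⟩ := (Ideal.mem_map_iff_of_surjective _ Ideal.Quotient.mk_surjective).mp h3
  rw [Ideal.Quotient.eq] at hyx
  have h4 : x = y + -(y - x) := by ring
  rw [h4]
  exact Submodule.add_mem_sup hy (neg_mem hyx)

theorem chevalley [IsAdicComplete (maximalIdeal R) R] (I : ℕ → Ideal R) (hI : Antitone I)
    (hk : ∀ k, maximalIdeal R ^ k ≤ I k) (j : ℕ) :
    ∃ n, ∀ x ∈ I n, ∃ y, (∀ k, y ∈ I k) ∧ x - y ∈ maximalIdeal R ^ j := by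
  choose n0 hn0 using stab_mod I hI
  let n : ℕ → ℕ := fun i => i + ∑ l ∈ Finset.range (i+1), n0 l
  have hnge : ∀ i, n0 i ≤ n i := fun i => by
    have := Finset.single_le_sum (f := n0) (fun _ _ => Nat.zero_le _)
      (Finset.self_mem_range_succ i)
    simp only [n]; omega
  have hmono : ∀ i, n i ≤ n (i+1) := fun i => by
    simp only [n]
    rw [Finset.sum_range_succ (n := i+1)]
    omega
  have hid : ∀ i, i ≤ n i := fun i => by simp only [n]; omega
  have hn : ∀ i, ∀ x ∈ I (n i), ∃ y ∈ I (n (i+1)), x - y ∈ maximalIdeal R ^ i := by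
    intro i x hx
    have := hn0 i (n (i+1)) ((hnge i).trans (hmono i)) (hI (hnge i) hx)
    obtain ⟨y, hy, z, hz, rfl⟩ := Submodule.mem_sup.mp this
    exact ⟨y, hy, by simpa using hz⟩
  choose! g hg hg' using hn
  refine ⟨n j, fun x hx => ?_⟩
  let s : ℕ → R := fun i => Nat.rec x (fun i y => g (j + i) y) i
  have hs : ∀ i, s i ∈ I (n (j + i)) := by
    intro i
    induction i with
    | zero => exact hx
    | succ i ih => exact hg _ _ ih
  have hs' : ∀ i, s i - s (i+1) ∈ maximalIdeal R ^ (j + i) := fun i => hg' _ _ (hs i)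
  have hc : ∀ a b, a ≤ b → s a - s b ∈ maximalIdeal R ^ (j + a) := by
    intro a b hab
    induction b, hab using Nat.le_induction with
    | base => simp
    | succ b hab ih =>
      have := add_mem ih (Ideal.pow_le_pow_right (by omega) (hs' b))
      simpa using this
  obtain ⟨y, hy⟩ := IsPrecomplete.prec (inferInstance : IsPrecomplete (maximalIdeal R) R)
    (f := s) (by
      intro a b hab
      rw [SModEq.sub_mem]
      simpa using Ideal.pow_le_pow_right (by omega) (hc a b hab))
  have hy' : ∀ a, s a - y ∈ maximalIdeal R ^ a := fun a => by
    have := hy a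
    rw [SModEq.sub_mem] at this
    simpa using this
  refine ⟨y, fun k => ?_, ?_⟩
  · have h1 : s k ∈ I k := hI (by have := hid (j + k); omega) (hs k)
    have := sub_mem h1 (hk k (hy' k))
    simpa using this
  · have := add_mem (Ideal.pow_le_pow_right (by omega) (hc 0 j (Nat.zero_le _))) (hy' j)
    simpa [s] using this

theorem double_ann [IsAdicComplete (maximalIdeal R) R] [IsArtinian R U] (hU : SimpleSocle R U)
    (K : Submodule R U) (e : U) (he : ∀ r : R, (∀ x ∈ K, r • x = 0) → r • e = 0) : e ∈ K := by
  let L : ℕ → Submodule R U := fun k =>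
    K ⊓ Submodule.torsionBySet R U (maximalIdeal R ^ k : Ideal R)
  have hL : ∀ k x, x ∈ L k ↔ x ∈ K ∧ ∀ r ∈ maximalIdeal R ^ k, r • x = 0 := by
    intro k x
    simp [L, Submodule.mem_torsionBySet_iff]
  let I : ℕ → Ideal R := fun k => (L k).annihilator
  have hIm : ∀ k r, r ∈ I k ↔ ∀ x ∈ L k, r • x = 0 := fun k r => Submodule.mem_annihilator
  have hI : Antitone I := by
    intro a b hab
    apply Submodule.annihilator_mono
    intro x hx
    rw [hL] at hx ⊢
    exact ⟨hx.1, fun r hr => hx.2 r (Ideal.pow_le_pow_right hab hr)⟩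
  obtain ⟨j, hj⟩ := torsion (R := R) e
  obtain ⟨n, hn⟩ := chevalley I hI (fun k r hr => by
    rw [hIm]; intro x hx; exact ((hL k x).mp hx).2 r hr) j
  have : e ∈ L n := by
    apply double_ann_fg hU
    · apply fg_of_torsion n
      intro r hr x hx
      exact ((hL n x).mp hx).2 r hr
    · intro r hr
      obtain ⟨y, hy, hxy⟩ := hn r ((hIm n r).mpr hr)
      have h1 : y • e = 0 := by
        apply he
        intro x hx
        obtain ⟨k, hk⟩ := torsion (R := R) x
        exact (hIm k y).mp (hy k) x ((hL k x).mpr ⟨hx, hk⟩)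
      have h2 := hj _ hxy
      rwa [sub_smul, h1, sub_zero] at h2
  exact ((hL n e).mp this).1

theorem stab_loc (𝔞 P : Ideal R) [P.IsPrime] (hP : P ∈ 𝔞.minimalPrimes) (b : ℕ → Ideal R)
    (hb : Antitone b) (ha : ∀ s, 𝔞 ≤ b s) :
    ∃ s0, ∀ s, s0 ≤ s → ∃ g, g ∉ P ∧ ∀ x ∈ b s, g * x ∈ b (s+1) := by
  let S := Localization.AtPrime P
  let f := algebraMap R S
  have hart : IsArtinianRing (S ⧸ 𝔞.map f) := by
    apply IsLocalRing.quotient_artinian_of_mem_minimalPrimes_of_isLocalRing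
    refine ⟨⟨(maximalIdeal.isMaximal S).isPrime, ?_⟩, ?_⟩
    · rw [← Localization.AtPrime.map_eq_maximalIdeal]
      exact Ideal.map_mono hP.1.2
    · rintro J ⟨hJ, hle⟩ hJm
      have h1 : (J.comap f).IsPrime := hJ.comap f
      have h2 : J.comap f ≤ P := by
        exact (Ideal.comap_mono hJm).trans (Localization.AtPrime.under_maximalIdeal (I := P)).le
      have h3 := hP.2 ⟨h1, Ideal.map_le_iff_le_comap.mp hle⟩ h2
      rw [← Localization.AtPrime.map_eq_maximalIdeal]
      exact Ideal.map_le_iff_le_comap.mpr h3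
  let F : ℕ →o (Ideal (S ⧸ 𝔞.map f))ᵒᵈ :=
    ⟨fun k => OrderDual.toDual (((b k).map f).map (Ideal.Quotient.mk _)), fun a b hab =>
      OrderDual.toDual_le_toDual.mpr (Ideal.map_mono (Ideal.map_mono (hb hab)))⟩
  obtain ⟨n, hn⟩ := IsArtinian.monotone_stabilizes F
  refine ⟨n, fun s hs => ?_⟩
  have h1 : ((b s).map f).map (Ideal.Quotient.mk (𝔞.map f)) =
      ((b (s+1)).map f).map (Ideal.Quotient.mk (𝔞.map f)) :=
    (hn s hs).symm.trans (hn (s+1) (by omega))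
  have h2 : (b s).map f ≤ (b (s+1)).map f := by
    intro x hx
    have h3 : Ideal.Quotient.mk (𝔞.map f) x ∈ _ := h1 ▸ Ideal.mem_map_of_mem _ hx
    obtain ⟨y, hy, hyx⟩ := (Ideal.mem_map_iff_of_surjective _ Ideal.Quotient.mk_surjective).mp h3
    rw [Ideal.Quotient.eq] at hyx
    have h4 := sub_mem hy (Ideal.map_mono (ha (s+1)) hyx)
    simpa using h4
  have h5 : ∀ x ∈ b s, ∃ g, g ∉ P ∧ g * x ∈ b (s+1) := by
    intro x hx
    have h6 := h2 (Ideal.mem_map_of_mem f hx)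
    obtain ⟨g, hg, h7⟩ := (IsLocalization.algebraMap_mem_map_algebraMap_iff P.primeCompl S _ _).mp h6
    exact ⟨g, hg, h7⟩
  obtain ⟨T, hT⟩ := Ideal.fg_of_isNoetherianRing (b s)
  choose! g hg hg' using h5
  have hTb : ∀ x ∈ T, x ∈ b s := fun x hx => hT ▸ Ideal.subset_span hx
  refine ⟨∏ x ∈ T, g x, ?_, ?_⟩
  · intro h
    obtain ⟨x, hx, h8⟩ := (Ideal.IsPrime.prod_mem_iff (p := P)).mp h
    exact hg x (hTb x hx) h8
  · have h9 : b s ≤ Submodule.comap (LinearMap.mulLeft R (∏ x ∈ T, g x)) (b (s+1)) := by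
      rw [← hT]
      refine Ideal.span_le.mpr fun x hx => ?_
      change (∏ x ∈ T, g x) * x ∈ b (s+1)
      classical
      rw [← Finset.prod_erase_mul _ _ hx, mul_assoc]
      exact Ideal.mul_mem_left _ _ (hg' x (hTb x hx))
    exact fun x hx => h9 hx

theorem chain_simple [IsAdicComplete (maximalIdeal R) R] [IsArtinian R U] (hU : SimpleSocle R U)
    (𝔞 P : Ideal R) [P.IsPrime] (hP : P ∈ 𝔞.minimalPrimes) (K : ℕ → Submodule R U)
    (hK : Monotone K) (ha : ∀ s, ∀ x ∈ K s, ∀ a ∈ 𝔞, a • x = 0) :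
    ∃ s0, ∀ s, s0 ≤ s → ∃ g, g ∉ P ∧ ∀ x ∈ K (s+1), g • x ∈ K s := by
  obtain ⟨s0, h⟩ := stab_loc 𝔞 P hP (fun s => (K s).annihilator)
    (fun a b hab => Submodule.annihilator_mono (hK hab))
    (fun s a has => Submodule.mem_annihilator.mpr fun x hx => ha s x hx a has)
  refine ⟨s0, fun s hs => ?_⟩
  obtain ⟨g, hg, h1⟩ := h s hs
  refine ⟨g, hg, fun x hx => double_ann hU _ _ fun r hr => ?_⟩
  have := Submodule.mem_annihilator.mp (h1 r (Submodule.mem_annihilator.mpr hr)) x hx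
  rw [smul_smul, mul_comm]
  exact this

theorem exists_max (x : U) (hx : x ≠ 0) :
    ∃ M : Submodule R U, x ∉ M ∧ ∀ M' : Submodule R U, M < M' → x ∈ M' := by
  obtain ⟨M, -, hM⟩ := zorn_le_nonempty₀ {M : Submodule R U | x ∉ M} (by
    intro c hc hch y hy
    refine ⟨sSup c, ?_, fun z hz => le_sSup hz⟩
    intro hmem
    obtain ⟨z, hz, hxz⟩ := (Submodule.mem_sSup_of_directed ⟨y, hy⟩ hch.directedOn).mp hmem
    exact hc hz hxz) ⊥ (by simpa using hx)
  refine ⟨M, hM.1, fun M' hlt => ?_⟩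
  by_contra hn
  exact absurd (hM.2 hn hlt.le) (not_le_of_gt hlt)

theorem simpleSocle_quot (x : U) (hx : ∀ r ∈ maximalIdeal R, r • x = 0) (M : Submodule R U)
    (hxM : x ∉ M) (hM : ∀ M' : Submodule R U, M < M' → x ∈ M') : SimpleSocle R (U ⧸ M) := by
  have key : ∀ y : U ⧸ M, y ≠ 0 → (∀ r ∈ maximalIdeal R, r • y = 0) →
      ∃ r : Rˣ, M.mkQ x = r • y := by
    intro y hy hy'
    obtain ⟨y, rfl⟩ := M.mkQ_surjective y
    have hyM : y ∉ M := fun h => hy (by simpa using h)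
    have h1 : x ∈ M ⊔ Submodule.span R {y} := by
      apply hM
      refine lt_of_le_of_ne le_sup_left fun h => hyM ?_
      rw [h]
      exact Submodule.mem_sup_right (Submodule.mem_span_singleton_self y)
    obtain ⟨z, hz, w, hw, h2⟩ := Submodule.mem_sup.mp h1
    obtain ⟨r, rfl⟩ := Submodule.mem_span_singleton.mp hw
    have h3 : M.mkQ x = r • M.mkQ y := by
      rw [← h2, map_add, map_smul]
      simp [hz]
    have h4 : IsUnit r := by
      by_contra hn
      rw [hy' r ((mem_maximalIdeal _).mpr hn)] at h3
      exact hxM (by simpa using h3)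
    obtain ⟨u, rfl⟩ := h4
    exact ⟨u, h3⟩
  intro a b ha ha0 hb
  by_cases hb0 : b = 0
  · exact ⟨0, by simp [hb0]⟩
  obtain ⟨u, hu⟩ := key a ha0 ha
  obtain ⟨v, hv⟩ := key b hb0 hb
  refine ⟨((v⁻¹ * u : Rˣ) : R), ?_⟩
  change b = (v⁻¹ * u) • a
  rw [mul_smul, ← hu, hv, inv_smul_smul]

theorem exists_socle [IsArtinian R U] (W : Submodule R U) (hW : W ≠ ⊥) :
    ∃ x ∈ W, x ≠ 0 ∧ ∀ r ∈ maximalIdeal R, r • x = 0 := by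
  obtain ⟨w, hw, hw0⟩ := Submodule.exists_mem_ne_zero_of_ne_bot hW
  classical
  have ht := torsion (R := R) w
  have hpos : Nat.find ht ≠ 0 := by
    intro h0
    have := Nat.find_spec ht
    rw [h0] at this
    exact hw0 (by simpa using this 1 (by simp))
  obtain ⟨n, hn⟩ := Nat.exists_eq_succ_of_ne_zero hpos
  have h1 := Nat.find_min ht (m := n) (by omega)
  push Not at h1
  obtain ⟨r, hr, hrw⟩ := h1
  refine ⟨r • w, W.smul_mem r hw, hrw, fun t htm => ?_⟩
  have h2 := Nat.find_spec ht
  rw [smul_smul]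
  apply h2
  rw [hn, Nat.succ_eq_add_one, pow_succ']
  exact Ideal.mul_mem_mul htm hr

theorem chain_general [IsAdicComplete (maximalIdeal R) R] [IsArtinian R U]
    (𝔞 P : Ideal R) [hPp : P.IsPrime] (hP : P ∈ 𝔞.minimalPrimes) (W : Submodule R U) :
    ∀ K : ℕ → Submodule R U, Monotone K → (∀ s, K s ≤ W) →
    (∀ s, ∀ x ∈ K s, ∀ a ∈ 𝔞, a • x = 0) →
    ∃ s0, ∀ s, s0 ≤ s → ∃ g, g ∉ P ∧ ∀ x ∈ K (s+1), g • x ∈ K s := by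
  induction W using WellFoundedLT.induction with
  | _ W ih =>
  intro K hK hKW ha
  by_cases hW : W = ⊥
  · refine ⟨0, fun s _ => ⟨1, fun h => hPp.ne_top ((Ideal.eq_top_iff_one _).mpr h), ?_⟩⟩
    intro x hx
    have : x = 0 := by simpa [hW] using hKW _ hx
    simp [this]
  obtain ⟨x, hxW, hx0, hx⟩ := exists_socle W hW
  obtain ⟨M, hxM, hM⟩ := exists_max (R := R) x hx0
  have hU := simpleSocle_quot x hx M hxM hM
  obtain ⟨s1, h1⟩ := chain_simple hU 𝔞 P hP (fun s => (K s).map M.mkQ)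
    (fun a b hab => Submodule.map_mono (hK hab)) (by
      rintro s _ ⟨y, hy, rfl⟩ a haa
      rw [← map_smul, ha s y hy a haa, map_zero])
  have hlt : M ⊓ W < W := by
    refine lt_of_le_of_ne inf_le_right fun h => hxM ?_
    have : x ∈ M ⊓ W := h.ge hxW
    exact this.1
  obtain ⟨s2, h2⟩ := ih _ hlt (fun s => M ⊓ K s)
    (fun a b hab => inf_le_inf_left _ (hK hab)) (fun s => inf_le_inf_left _ (hKW s))
    (fun s y hy a haa => ha s y hy.2 a haa)
  refine ⟨max s1 s2, fun s hs => ?_⟩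
  obtain ⟨g1, hg1, h3⟩ := h1 s (le_trans (le_max_left _ _) hs)
  obtain ⟨g2, hg2, h4⟩ := h2 s (le_trans (le_max_right _ _) hs)
  refine ⟨g2 * g1, fun h => (hPp.mem_or_mem h).elim hg2 hg1, fun y hy => ?_⟩
  obtain ⟨z, hz, hzy⟩ := h3 _ ⟨y, hy, rfl⟩
  have h5 : g1 • y - z ∈ M := by
    rw [← map_smul, eq_comm, ← sub_eq_zero, ← map_sub] at hzy
    exact (Submodule.Quotient.mk_eq_zero _).mp hzy
  have h6 := h4 (g1 • y - z)
    ⟨h5, sub_mem ((K (s+1)).smul_mem g1 hy) (hK (Nat.le_succ s) hz)⟩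
  have h7 := (K s).add_mem h6.2 ((K s).smul_mem g2 hz)
  rw [← smul_add, sub_add_cancel, smul_smul] at h7
  exact h7

end

section
variable {R : Type*} [CommRing R] {N : Type*} [AddCommGroup N] [Module R N]

theorem iter_smul (q : ℕ) (φ : N →+ N)
    (hφ : ∀ (r : R) (n : N), φ (r • n) = r ^ q • φ n) (s : ℕ) (r : R) (n : N) :
    (⇑φ)^[s] (r • n) = r ^ (q ^ s) • (⇑φ)^[s] n := by
  induction s with
  | zero => simp
  | succ s ih => rw [Function.iterate_succ_apply', ih, hφ, Function.iterate_succ_apply',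
      ← pow_mul, pow_succ]

/-- The kernel of the `s`-th iterate of `φ`. -/
def kerIter (q : ℕ) (φ : N →+ N)
    (hφ : ∀ (r : R) (n : N), φ (r • n) = r ^ q • φ n) (s : ℕ) : Submodule R N where
  carrier := {n | (⇑φ)^[s] n = 0}
  add_mem' {a b} ha hb := by
    simp only [Set.mem_ofPred_eq] at *
    rw [iterate_map_add, ha, hb, add_zero]
  zero_mem' := by simp [iterate_map_zero]
  smul_mem' r n hn := by
    simp only [Set.mem_ofPred_eq] at *
    rw [iter_smul q φ hφ, hn, smul_zero]

theorem main_complete [IsNoetherianRing R] [IsLocalRing R] [IsAdicComplete (maximalIdeal R) R]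
    [IsArtinian R N] (q : ℕ) (hq : 2 ≤ q) (φ : N →+ N)
    (hφ : ∀ (r : R) (n : N), φ (r • n) = r ^ q • φ n) :
    ∃ s : ℕ, 1 ≤ s ∧ ∀ n : N, (∃ k : ℕ, 1 ≤ k ∧ (⇑φ)^[k] n = 0) → (⇑φ)^[s] n = 0 := by
  let K := kerIter q φ hφ
  have hKm : ∀ s n, n ∈ K s ↔ (⇑φ)^[s] n = 0 := fun s n => Iff.rfl
  have hKs : ∀ s n, n ∈ K (s+1) ↔ φ n ∈ K s := fun s n => by
    rw [hKm, hKm, Function.iterate_succ_apply]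
  have hK : Monotone K := by
    refine monotone_nat_of_le_succ fun s n hn => ?_
    rw [hKm] at hn ⊢
    rw [Function.iterate_succ_apply', hn, map_zero]
  let c : ℕ → Ideal R := fun s => (K s).colon (K (s+1) : Set N)
  have hc : ∀ s r, r ∈ c s ↔ ∀ n ∈ K (s+1), r • n ∈ K s := fun s r => Submodule.mem_colon
  have hroot : ∀ s r, r ^ q ∈ c s → r ∈ c (s+1) := by
    intro s r hr
    rw [hc] at hr ⊢
    intro n hn
    rw [hKs, hφ]
    exact hr _ ((hKs _ _).mp hn)
  have hcm : Monotone c := monotone_nat_of_le_succ fun s r hr =>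
    hroot s r (Ideal.pow_mem_of_mem _ hr _ (by omega))
  obtain ⟨s0, hs0⟩ := monotone_stabilizes_iff_noetherian.mpr
    (inferInstance : IsNoetherian R R) ⟨c, hcm⟩
  have hs0' : ∀ s, s0 ≤ s → c s = c s0 := fun s hs => (hs0 s hs).symm
  have hsq : ∀ g ∈ c s0, ∀ s, ∀ n ∈ K s, g ^ 2 • n ∈ K s0 := by
    intro g hg s
    induction s with
    | zero => intro n hn; exact Submodule.smul_mem _ _ (hK (Nat.zero_le _) hn)
    | succ s ih =>
      intro n hn
      have h1 := ih _ ((hKs _ _).mp hn)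
      have h2 : φ (g • n) ∈ K s0 := by
        rw [hφ, ← Nat.sub_add_cancel hq, pow_add, mul_smul]
        exact Submodule.smul_mem _ _ h1
      have h3 := (hc _ _).mp hg _ ((hKs _ _).mpr h2)
      rwa [smul_smul, ← pow_two] at h3
  let 𝔞 : Ideal R := ⨅ s, (K s0).colon (K s : Set N)
  have h𝔞 : ∀ r, r ∈ 𝔞 ↔ ∀ s, ∀ n ∈ K s, r • n ∈ K s0 := fun r => by
    simp only [𝔞, Ideal.mem_iInf, Submodule.mem_colon]; rfl
  by_cases htop : 𝔞 = ⊤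
  · refine ⟨s0 + 1, by omega, ?_⟩
    rintro n ⟨k, -, hk⟩
    have h1 := (h𝔞 1).mp (htop ▸ Submodule.mem_top) k n hk
    rw [one_smul] at h1
    exact hK (Nat.le_succ s0) h1
  exfalso
  obtain ⟨P, hP⟩ := Ideal.nonempty_minimalPrimes htop
  haveI hPp : P.IsPrime := hP.1.1
  obtain ⟨s1, h1⟩ := chain_general 𝔞 P hP (⊤ : Submodule R (N ⧸ K s0))
    (fun s => (K s).map (K s0).mkQ) (fun a b hab => Submodule.map_mono (hK hab))
    (fun _ => le_top) (by
      rintro s _ ⟨n, hn, rfl⟩ a ha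
      rw [← map_smul]
      exact (Submodule.Quotient.mk_eq_zero _).mpr ((h𝔞 a).mp ha s n hn))
  obtain ⟨g, hg, h2⟩ := h1 (max s0 s1) (le_max_right _ _)
  apply hg
  have h3 : g ∈ c s0 := by
    rw [← hs0' (max s0 s1) (le_max_left _ _), hc]
    intro n hn
    obtain ⟨z, hz, hzn⟩ := h2 _ ⟨n, hn, rfl⟩
    rw [← map_smul, eq_comm, ← sub_eq_zero, ← map_sub] at hzn
    have h4 : g • n - z ∈ K s0 := (Submodule.Quotient.mk_eq_zero _).mp hzn
    have h5 := add_mem (hK (le_max_left s0 s1) h4) hz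
    simpa using h5
  have h4 : g ^ 2 ∈ 𝔞 := (h𝔞 _).mpr (hsq g h3)
  exact hPp.mem_of_pow_mem _ (hP.1.2 h4)

end
end HSL

namespace HSL
open IsLocalRing

theorem noeth_of_poly {P R : Type*} [CommRing P] [CommRing R] [IsNoetherianRing R] [IsLocalRing R]
    (J : Ideal P) (hfg : J.FG) (hB : IsNoetherianRing (AdicCompletion J P)) (f : P →+* R)
    (hf : Function.Surjective f) (hJ : J.map f = maximalIdeal R) :
    IsNoetherianRing (AdicCompletion (maximalIdeal R) R) := by
  have hle : ∀ n, J ^ n ≤ (maximalIdeal R ^ n).comap f := fun n => by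
    rw [← Ideal.map_le_iff_le_comap, Ideal.map_pow, hJ]
  let F : ∀ n, AdicCompletion J P →+* R ⧸ maximalIdeal R ^ n := fun n =>
    (Ideal.quotientMap (maximalIdeal R ^ n) f (hle n)).comp
      (AdicCompletion.evalₐ J n : AdicCompletion J P →+* P ⧸ J ^ n)
  have hF : ∀ {m n : ℕ} (hle : m ≤ n),
      (Ideal.Quotient.factorPow (maximalIdeal R) hle).comp (F n) = F m := by
    intro m n hmn
    ext a
    obtain ⟨a, rfl⟩ := AdicCompletion.mk_surjective _ _ a
    simp only [F, RingHom.comp_apply, RingHom.coe_coe, AdicCompletion.evalₐ_mk]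
    change (Ideal.Quotient.mk _ (f (a n)) : R ⧸ maximalIdeal R ^ m) = Ideal.Quotient.mk _ (f (a m))
    rw [Ideal.Quotient.eq, ← map_sub]
    apply hle m
    rw [← Ideal.Quotient.eq]
    exact (AdicCompletion.Ideal.mk_eq_mk J hmn a)
  let Θ := AdicCompletion.liftRingHom (maximalIdeal R) F hF
  have hΘ : ∀ x : P, Θ (algebraMap _ _ x) = algebraMap R _ (f x) := by
    intro x
    apply AdicCompletion.ext_evalₐ
    intro n
    rw [AdicCompletion.evalₐ_liftRingHom]
    simp only [F, RingHom.comp_apply, RingHom.coe_coe, AlgHom.commutes]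
    rfl
  have hmap : (J.map (algebraMap P (AdicCompletion J P))).map Θ =
      maximalIdeal (AdicCompletion (maximalIdeal R) R) := by
    have h1 : (maximalIdeal R).map (algebraMap R (AdicCompletion (maximalIdeal R) R)) =
        (J.map f).map (algebraMap R (AdicCompletion (maximalIdeal R) R)) :=
      congrArg (Ideal.map (algebraMap R (AdicCompletion (maximalIdeal R) R))) hJ.symm
    have h2 : Θ.comp (algebraMap P (AdicCompletion J P)) =
        (algebraMap R (AdicCompletion (maximalIdeal R) R)).comp f := RingHom.ext hΘ
    rw [AdicCompletion.maximalIdeal_eq_map, h1, Ideal.map_map, Ideal.map_map, h2]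
  have := AdicCompletion.isAdicComplete_self J hfg
  have hsurj : Function.Surjective Θ := by
    have : IsHausdorff ((J.map (algebraMap P (AdicCompletion J P))).map Θ)
      (AdicCompletion (maximalIdeal R) R) := by rw [hmap]; infer_instance
    apply surjective_of_mk_map_comp_surjective (I := J.map (algebraMap P (AdicCompletion J P)))
    intro y
    obtain ⟨y, rfl⟩ := Ideal.Quotient.mk_surjective y
    obtain ⟨r, hr⟩ := Ideal.Quotient.mk_surjective (AdicCompletion.evalOneₐ (maximalIdeal R) y)
    obtain ⟨x, rfl⟩ := hf r
    refine ⟨algebraMap _ _ x, ?_⟩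
    rw [RingHom.comp_apply, hΘ, Ideal.Quotient.eq, hmap, AdicCompletion.maximalIdeal_eq_map,
      ← AdicCompletion.ker_evalOneₐ_eq_map _ (maximalIdeal R).fg_of_isNoetherianRing,
      RingHom.mem_ker, map_sub, sub_eq_zero]
    exact ((AdicCompletion.evalOneₐ (maximalIdeal R)).commutes (f x)).trans hr
  exact isNoetherianRing_of_surjective _ _ Θ hsurj

theorem noeth_completion {R : Type*} [CommRing R] [IsNoetherianRing R] [IsLocalRing R] :
    IsNoetherianRing (AdicCompletion (maximalIdeal R) R) := by
  obtain ⟨d, x, hx⟩ := Submodule.fg_iff_exists_fin_generating_family.mp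
    (maximalIdeal R).fg_of_isNoetherianRing
  have hB : IsNoetherianRing (AdicCompletion (MvPolynomial.idealOfVars (Fin d) R)
      (MvPolynomial (Fin d) R)) :=
    isNoetherianRing_of_ringEquiv _
      (MvPowerSeries.toAdicCompletionAlgEquiv (Fin d) R).toRingEquiv
  refine noeth_of_poly (MvPolynomial.idealOfVars (Fin d) R) (MvPolynomial.idealOfVars_fg _ _) hB
    (MvPolynomial.aeval x : MvPolynomial (Fin d) R →ₐ[R] R).toRingHom
    (fun r => ⟨MvPolynomial.C r, by simp⟩) ?_
  rw [MvPolynomial.idealOfVars, Ideal.map_span, ← Set.range_comp, ← hx]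
  change Submodule.span R _ = _
  congr 2
  ext i
  simp

section
variable {R : Type*} [CommRing R] [IsNoetherianRing R] [IsLocalRing R]
  {N : Type*} [AddCommGroup N] [Module R N] [IsArtinian R N]

theorem exists_rep (a : AdicCompletion (maximalIdeal R) R) (k : ℕ) :
    ∃ r : R, Ideal.Quotient.mk (maximalIdeal R ^ k) r = AdicCompletion.evalₐ _ k a :=
  Ideal.Quotient.mk_surjective _

/-- `a` agrees with `r` modulo some power of the maximal ideal killing `n`. -/
def Rep (a : AdicCompletion (maximalIdeal R) R) (n : N) (r : R) : Prop :=
  ∃ k, (∀ s ∈ maximalIdeal R ^ k, s • n = 0) ∧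
    Ideal.Quotient.mk (maximalIdeal R ^ k) r = AdicCompletion.evalₐ _ k a

theorem evalₐ_mono (a : AdicCompletion (maximalIdeal R) R) {k l : ℕ} (h : k ≤ l) (r : R)
    (hr : Ideal.Quotient.mk (maximalIdeal R ^ l) r = AdicCompletion.evalₐ _ l a) :
    Ideal.Quotient.mk (maximalIdeal R ^ k) r = AdicCompletion.evalₐ _ k a := by
  obtain ⟨a, rfl⟩ := AdicCompletion.mk_surjective _ _ a
  rw [AdicCompletion.evalₐ_mk] at hr ⊢
  rw [Ideal.Quotient.eq] at hr
  rw [AdicCompletion.Ideal.mk_eq_mk _ h a |>.symm, Ideal.Quotient.eq]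
  exact Ideal.pow_le_pow_right h hr

theorem Rep.unique {a : AdicCompletion (maximalIdeal R) R} {n : N} {r s : R}
    (hr : Rep a n r) (hs : Rep a n s) : r • n = s • n := by
  have key : ∀ (k l : ℕ) (r s : R), k ≤ l → (∀ s ∈ maximalIdeal R ^ k, s • n = 0) →
      Ideal.Quotient.mk (maximalIdeal R ^ k) r = AdicCompletion.evalₐ _ k a →
      Ideal.Quotient.mk (maximalIdeal R ^ l) s = AdicCompletion.evalₐ _ l a → r • n = s • n := by
    intro k l r s hkl hk hr hs
    have h := evalₐ_mono a hkl s hs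
    rw [← h, Ideal.Quotient.eq] at hr
    have := hk _ hr
    rwa [sub_smul, sub_eq_zero] at this
  obtain ⟨k, hk, hr⟩ := hr
  obtain ⟨l, hl, hs⟩ := hs
  rcases le_total k l with h | h
  · exact key k l r s h hk hr hs
  · exact (key l k s r h hl hs hr).symm

theorem exists_common (a : AdicCompletion (maximalIdeal R) R) (n n' : N) :
    ∃ r, Rep a n r ∧ Rep a n' r ∧ Rep a (n + n') r := by
  obtain ⟨k, hk⟩ := torsion (R := R) n
  obtain ⟨l, hl⟩ := torsion (R := R) n'
  obtain ⟨r, hr⟩ := exists_rep a (max k l)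
  have h1 := fun s (hs : s ∈ maximalIdeal R ^ max k l) =>
    hk s (Ideal.pow_le_pow_right (le_max_left _ _) hs)
  have h2 := fun s (hs : s ∈ maximalIdeal R ^ max k l) =>
    hl s (Ideal.pow_le_pow_right (le_max_right _ _) hs)
  refine ⟨r, ⟨_, h1, hr⟩, ⟨_, h2, hr⟩, ⟨_, fun s hs => ?_, hr⟩⟩
  rw [smul_add, h1 s hs, h2 s hs, add_zero]

theorem exists_common_ring (a b : AdicCompletion (maximalIdeal R) R) (n : N) :
    ∃ r s, Rep a n r ∧ Rep b n s ∧ Rep (a + b) n (r + s) ∧ Rep (a * b) n (r * s) ∧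
      Rep a (s • n) r := by
  obtain ⟨k, hk⟩ := torsion (R := R) n
  obtain ⟨r, hr⟩ := exists_rep a k
  obtain ⟨s, hs⟩ := exists_rep b k
  refine ⟨r, s, ⟨k, hk, hr⟩, ⟨k, hk, hs⟩, ⟨k, hk, by rw [map_add, map_add, hr, hs]⟩,
    ⟨k, hk, by rw [map_mul, map_mul, hr, hs]⟩, ⟨k, fun t ht => ?_, hr⟩⟩
  rw [smul_comm, hk t ht, smul_zero]

theorem rep_algebraMap (r : R) (n : N) : Rep (algebraMap R (AdicCompletion (maximalIdeal R) R) r) n r := by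
  obtain ⟨k, hk⟩ := torsion (R := R) n
  refine ⟨k, hk, ?_⟩
  rw [AlgHom.commutes]
  rfl

/-- the action of the completion on an Artinian module. -/
noncomputable def act (a : AdicCompletion (maximalIdeal R) R) (n : N) : N :=
  (exists_common a n n).choose • n

theorem act_eq {a : AdicCompletion (maximalIdeal R) R} {n : N} {r : R} (h : Rep a n r) :
    act a n = r • n :=
  (exists_common a n n).choose_spec.1.unique h

/-- the module structure over the completion. -/
@[reducible]
noncomputable def completionModule : Module (AdicCompletion (maximalIdeal R) R) N where
  smul := act
  one_smul n := by
    change act 1 n = n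
    have := rep_algebraMap (1 : R) n
    rw [map_one] at this
    rw [act_eq this, one_smul]
  mul_smul a b n := by
    change act (a * b) n = act a (act b n)
    obtain ⟨r, s, h1, h2, h3, h4, h5⟩ := exists_common_ring a b n
    rw [act_eq h2, act_eq h4, act_eq h5, mul_smul]
  smul_zero a := by
    change act a (0 : N) = 0
    obtain ⟨r, h, -⟩ := exists_common a (0 : N) 0
    rw [act_eq h, smul_zero]
  smul_add a n n' := by
    change act a (n + n') = act a n + act a n'
    obtain ⟨r, h1, h2, h3⟩ := exists_common a n n'
    rw [act_eq h1, act_eq h2, act_eq h3, smul_add]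
  add_smul a b n := by
    change act (a + b) n = act a n + act b n
    obtain ⟨r, s, h1, h2, h3, h4, h5⟩ := exists_common_ring a b n
    rw [act_eq h1, act_eq h2, act_eq h3, add_smul]
  zero_smul n := by
    change act 0 n = 0
    have := rep_algebraMap (0 : R) n
    rw [map_zero] at this
    rw [act_eq this, zero_smul]

theorem main_local (q : ℕ) (hq : 2 ≤ q) (φ : N →+ N)
    (hφ : ∀ (r : R) (n : N), φ (r • n) = r ^ q • φ n) :
    ∃ s : ℕ, 1 ≤ s ∧ ∀ n : N, (∃ k : ℕ, 1 ≤ k ∧ (⇑φ)^[k] n = 0) → (⇑φ)^[s] n = 0 := by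
  letI : Module (AdicCompletion (maximalIdeal R) R) N := completionModule
  have hN : IsNoetherianRing (AdicCompletion (maximalIdeal R) R) := noeth_completion
  have htow : IsScalarTower R (AdicCompletion (maximalIdeal R) R) N :=
    IsScalarTower.of_algebraMap_smul fun r n => act_eq (rep_algebraMap r n)
  have hArt : IsArtinian (AdicCompletion (maximalIdeal R) R) N := isArtinian_of_tower R inferInstance
  refine main_complete (R := AdicCompletion (maximalIdeal R) R) q hq φ fun a n => ?_
  obtain ⟨r, h1, ⟨k, hk, hr⟩, -⟩ := exists_common a n (φ n)
  have h3 : Rep (a ^ q) (φ n) (r ^ q) := ⟨k, hk, by rw [map_pow, map_pow, hr]⟩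
  change φ (act a n) = act (a ^ q) (φ n)
  rw [act_eq h1, act_eq h3, hφ]

end
end HSL

/-- If `φ` is an action of the `t`-fold Frobenius on an Artinian module `N`, then the
nilpotent elements of `N` are killed by a single fixed power of `φ`. -/
theorem stmt10 {R : Type*} [CommRing R] [IsNoetherianRing R] [IsLocalRing R]
    (p : ℕ) (hp : p.Prime) [CharP R p]
    (hreg : IsRegularStmt R)
    {N : Type*} [AddCommGroup N] [Module R N] [IsArtinian R N]
    (t : ℕ) (ht : 1 ≤ t) (φ : N →+ N)
    (hφ : ∀ (r : R) (n : N), φ (r • n) = r ^ (p ^ t) • φ n) :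
    ∃ s : ℕ, 1 ≤ s ∧ ∀ n : N, (∃ k : ℕ, 1 ≤ k ∧ (⇑φ)^[k] n = 0) → (⇑φ)^[s] n = 0 := by
  exact HSL.main_local (p ^ t) (hp.two_le.trans (Nat.le_self_pow (by omega) p)) φ hφ
end

section
/- Let R be a complete regular local ring of prime characteristic p > 0, let g ∈ R, let a and β be positive integers, and set γ = a/(p^β − 1). Then there exists a real number c ∈ (0, γ) such that τ((g)^d) = τ((g)^c) for every real number d ∈ (c, γ). -/
open IsLocalRing

theorem aux_dim_le {R : Type*} [CommRing R] [IsNoetherianRing R] [IsLocalRing R]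
    (s : Finset R) (hs : maximalIdeal R = Ideal.span (s : Set R)) :
    ringKrullDim R ≤ s.card := by
  refine (ringKrullDim_le_spanFinrank_maximalIdeal R).trans ?_
  rw [hs]
  have := Submodule.spanFinrank_span_le_ncard_of_finite (R := R) (s.finite_toSet)
  rw [Set.ncard_coe_finset] at this
  exact_mod_cast this

theorem aux_map_max {R : Type*} [CommRing R] [IsLocalRing R]
    (I : Ideal R) [IsLocalRing (R ⧸ I)] :
    maximalIdeal (R ⧸ I) = (maximalIdeal R).map (Ideal.Quotient.mk I) := by
  have : IsLocalHom (Ideal.Quotient.mk I) := .of_surjective _ Ideal.Quotient.mk_surjective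
  rw [← IsLocalRing.maximalIdeal_comap (Ideal.Quotient.mk I),
    Ideal.map_comap_of_surjective _ Ideal.Quotient.mk_surjective]

theorem aux_domain (n : ℕ) : ∀ {R : Type*} [CommRing R] [IsNoetherianRing R] [IsLocalRing R]
    (s : Finset R) (_ : maximalIdeal R = Ideal.span (s : Set R)) (_ : s.card ≤ n)
    (_ : (n : WithBot ℕ∞) ≤ ringKrullDim R), IsDomain R := by
  classical
  induction n with
  | zero =>
    intro R _ _ _ s hs hc hd
    have : s = ∅ := by simpa using hc
    subst this
    have hm : maximalIdeal R = ⊥ := by simpa using hs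
    have : (⊥ : Ideal R).IsPrime := hm ▸ inferInstance
    exact (IsDomain.of_bot_isPrime R)
  | succ n ih =>
    intro R _ _ _ s hs hc hd
    -- choose x
    have hdim0 : ¬ ringKrullDim R ≤ 0 := by
      intro h
      have := hd.trans h
      have h2 : ((n+1 : ℕ) : WithBot ℕ∞) ≤ ((0:ℕ) : WithBot ℕ∞) := by simp at this
      have : n + 1 ≤ 0 := by exact_mod_cast h2
      omega
    have hx : ∃ x ∈ maximalIdeal R, x ∉ (maximalIdeal R)^2 ∧ ∀ q ∈ minimalPrimes R, x ∉ q := by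
      by_contra! hcon
      have hsub : ((maximalIdeal R : Ideal R) : Set R) ⊆
          ⋃ i ∈ (insert ((maximalIdeal R)^2) (minimalPrimes R)), ((id i : Ideal R) : Set R) := by
        intro x hx
        by_cases h2 : x ∈ (maximalIdeal R)^2
        · exact Set.mem_biUnion (Set.mem_insert _ _) h2
        · obtain ⟨q, hq, hxq⟩ := hcon x hx h2
          exact Set.mem_biUnion (Set.mem_insert_of_mem _ hq) hxq
      rw [Ideal.subset_union_prime_finite ((minimalPrimes.finite_of_isNoetherianRing R).insert _)
        ((maximalIdeal R)^2) ((maximalIdeal R)^2)] at hsub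
      · obtain ⟨i, hi, hle⟩ := hsub
        rcases hi with rfl | hi
        · have : maximalIdeal R = ⊥ := by
            refine Submodule.eq_bot_of_le_smul_of_le_jacobson_bot (maximalIdeal R) _
              (IsNoetherian.noetherian _) ?_ (IsLocalRing.maximalIdeal_le_jacobson _)
            simpa [pow_two] using hle
          have h2 := aux_dim_le (R := R) ∅ (by simpa using this)
          exact hdim0 (by simpa using h2)
        · have hip : i.IsPrime := hi.1.1
          have him : i = maximalIdeal R := le_antisymm (le_maximalIdeal hip.ne_top) hle
          have : ringKrullDim R ≤ 0 := by
            rw [← IsLocalRing.maximalIdeal_height_eq_ringKrullDim, ← him,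
              Ideal.height_eq_zero_iff.2 hi]
            simp
          exact hdim0 this
      · intro i hi h1 _
        rcases hi with rfl | hi
        · exact absurd rfl h1
        · exact hi.1.1
    obtain ⟨x, hxm, hx2, hxq⟩ := hx
    -- exchange
    obtain ⟨y, hy, hspan⟩ : ∃ y ∈ s, maximalIdeal R = Ideal.span {x} ⊔ Ideal.span ((s.erase y : Finset R) : Set R) := by
      have hx' := hxm
      rw [hs] at hx'
      obtain ⟨c, hc⟩ := (Submodule.mem_span_finset'.1 hx')
      have : ∃ y : s, IsUnit (c y) := by
        by_contra! hcon
        apply hx2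
        rw [← hc, pow_two]
        refine Ideal.sum_mem _ fun i _ => ?_
        refine Ideal.mul_mem_mul ((mem_maximalIdeal _).2 (hcon i)) ?_
        rw [hs]; exact Ideal.subset_span i.2
      obtain ⟨y, hy⟩ := this
      refine ⟨y, y.2, le_antisymm ?_ ?_⟩
      · have key : (y : R) ∈ Ideal.span {x} ⊔ Ideal.span ((s.erase y : Finset R) : Set R) := by
          rw [← Ideal.unit_mul_mem_iff_mem _ hy]
          rw [← Finset.add_sum_erase _ _ (Finset.mem_univ y)] at hc
          have : c y * (y : R) = x - ∑ i ∈ Finset.univ.erase y, c i • (i : R) := by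
            rw [← hc]; simp
          rw [this]
          refine Ideal.sub_mem _ (Ideal.mem_sup_left (Ideal.mem_span_singleton_self x)) ?_
          refine Ideal.sum_mem _ fun i hi => Ideal.mul_mem_left _ _ (Ideal.mem_sup_right (Ideal.subset_span ?_))
          have : i ≠ y := (Finset.mem_erase.1 hi).1
          rw [Finset.mem_coe, Finset.mem_erase]
          exact ⟨fun h => this (Subtype.ext h), i.2⟩
        conv_lhs => rw [hs]
        rw [Ideal.span_le]
        intro z hz
        by_cases hzy : z = y
        · rw [hzy]; exact key
        · exact Ideal.mem_sup_right (Ideal.subset_span (by simp [hzy]; exact hz))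
      · refine sup_le ((Ideal.span_singleton_le_iff_mem _).2 hxm) ?_
        conv_rhs => rw [hs]
        exact Ideal.span_mono (by simp)
    have hne : Ideal.span {x} ≠ ⊤ := fun h => (maximalIdeal.isMaximal R).ne_top
      (top_le_iff.1 (h ▸ (Ideal.span_singleton_le_iff_mem _).2 hxm))
    have : Nontrivial (R ⧸ Ideal.span {x}) := Ideal.Quotient.nontrivial_iff.2 hne
    have : IsLocalRing (R ⧸ Ideal.span {x}) := .of_surjective' _ Ideal.Quotient.mk_surjective
    have hdom : IsDomain (R ⧸ Ideal.span {x}) := by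
      refine ih ((s.erase y).image (Ideal.Quotient.mk (Ideal.span {x}))) ?_ ?_ ?_
      · rw [aux_map_max, hspan, Ideal.map_sup, Ideal.map_quotient_self, Ideal.map_span]
        simp
      · refine Finset.card_image_le.trans ?_
        rw [Finset.card_erase_of_mem hy]; omega
      · have h1 := ringKrullDim_le_ringKrullDim_quotient_add_encard (R := R) {x}
          (by rw [IsLocalRing.ringJacobson_eq_maximalIdeal]; simpa using hxm)
        have h2 := hd.trans h1
        rw [Set.encard_singleton] at h2
        push_cast at h2
        exact (ENat.WithBot.add_le_add_one_right_iff).1 h2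
    have hpr : (Ideal.span {x}).IsPrime := (Ideal.Quotient.isDomain_iff_prime _).1 hdom
    obtain ⟨q, hq, hqle⟩ := Ideal.exists_minimalPrimes_le (I := (⊥ : Ideal R)) (J := Ideal.span {x}) bot_le
    have hqp : q.IsPrime := hq.1.1
    have hq0 : q = ⊥ := by
      refine Submodule.eq_bot_of_le_smul_of_le_jacobson_bot (maximalIdeal R) _
              (IsNoetherian.noetherian _) ?_ (IsLocalRing.maximalIdeal_le_jacobson _)
      intro z hz
      obtain ⟨w, rfl⟩ := Ideal.mem_span_singleton.1 (hqle hz)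
      have := (hqp.mem_or_mem hz).resolve_left (hxq q hq)
      exact Submodule.smul_mem_smul hxm this
    subst hq0
    exact (IsDomain.of_bot_isPrime R)

/-- colon ideal -/
def col {R : Type*} [CommRing R] (I : Ideal R) (s : R) : Ideal R :=
  Submodule.comap (LinearMap.lsmul R R s) I

theorem mem_col {R : Type*} [CommRing R] {I : Ideal R} {s x : R} : x ∈ col I s ↔ s * x ∈ I :=
  Iff.rfl

/-- colength -/
noncomputable def len {R : Type*} [CommRing R] (I : Ideal R) : ℕ∞ := Module.length R (R ⧸ I)

theorem len_col {R : Type*} [CommRing R] (K : Ideal R) (s : R) :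
    len K = len (col K s) + len (K ⊔ Ideal.span {s}) := by
  have hle : K ≤ K ⊔ Ideal.span {s} := le_sup_left
  have hcol : col K s ≤ Submodule.comap (LinearMap.lsmul R R s) K := fun x hx => hx
  refine Module.length_eq_add_of_exact
    (Submodule.mapQ (col K s) K (LinearMap.lsmul R R s) hcol)
    (Submodule.mapQ K (K ⊔ Ideal.span {s}) LinearMap.id hle) ?_ ?_ ?_
  · rw [← LinearMap.ker_eq_bot, Submodule.ker_mapQ]
    change Submodule.map (Submodule.mkQ (col K s)) (col K s) = ⊥
    exact Submodule.mkQ_map_self _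
  · intro y
    obtain ⟨y, rfl⟩ := Submodule.Quotient.mk_surjective _ y
    exact ⟨Submodule.Quotient.mk y, rfl⟩
  · intro y
    obtain ⟨y, rfl⟩ := Submodule.Quotient.mk_surjective _ y
    rw [Submodule.mapQ_apply, Submodule.Quotient.mk_eq_zero, LinearMap.id_apply]
    constructor
    · intro h
      obtain ⟨k, hk, z, hz, rfl⟩ := Submodule.mem_sup.1 h
      obtain ⟨w, rfl⟩ := Ideal.mem_span_singleton.1 hz
      refine ⟨Submodule.Quotient.mk w, ?_⟩
      rw [Submodule.mapQ_apply]
      refine (Submodule.Quotient.eq _).2 ?_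
      simpa using hk
    · rintro ⟨z, hz⟩
      obtain ⟨z, rfl⟩ := Submodule.Quotient.mk_surjective _ z
      rw [Submodule.mapQ_apply] at hz
      have := (Submodule.Quotient.eq _).1 hz
      have h3 : y = (-(s * z - y)) + s * z := by ring
      rw [h3]
      exact Submodule.add_mem_sup (neg_mem this) (Ideal.mem_span_singleton'.2 ⟨z, mul_comm _ _⟩)

theorem len_anti {R : Type*} [CommRing R] {K K' : Ideal R} (h : K ≤ K') : len K' ≤ len K :=
  Module.length_le_of_surjective (Submodule.mapQ K K' LinearMap.id h) (by
    intro y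
    obtain ⟨y, rfl⟩ := Submodule.Quotient.mk_surjective _ y
    exact ⟨Submodule.Quotient.mk y, rfl⟩)

theorem len_max {R : Type*} [CommRing R] [IsLocalRing R] : len (maximalIdeal R) = 1 := by
  have : IsSimpleModule R (R ⧸ maximalIdeal R) :=
    isSimpleModule_iff_isCoatom.2 (maximalIdeal.isMaximal R).out
  exact Module.length_eq_one _ _

theorem len_eq_zero {R : Type*} [CommRing R] {K : Ideal R} : len K = 0 ↔ K = ⊤ := by
  rw [len, Module.length_eq_zero_iff, Submodule.Quotient.subsingleton_iff]

theorem len_ne_top {R : Type*} [CommRing R] [IsNoetherianRing R] [IsLocalRing R] {K : Ideal R}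
    {n : ℕ} (h : maximalIdeal R ^ n ≤ K) : len K ≠ ⊤ := by
  have hA : IsArtinianRing (R ⧸ K) := by
    by_cases hK : K = ⊤
    · have : Subsingleton (R ⧸ K) := Ideal.Quotient.subsingleton_iff.2 hK
      infer_instance
    refine IsLocalRing.quotient_artinian_of_mem_minimalPrimes_of_isLocalRing K ?_
    refine ⟨⟨inferInstance, le_maximalIdeal hK⟩, ?_⟩
    rintro q ⟨hq, hKq⟩ -
    exact hq.le_of_pow_le (h.trans hKq)
  have : IsArtinian R (R ⧸ K) := isArtinian_of_surjective_algebraMap (R := R ⧸ K) Ideal.Quotient.mk_surjective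
  exact Module.length_ne_top (R := R)

/-- for `K ≤ K'` of finite equal colength, equality -/
theorem eq_of_len {R : Type*} [CommRing R] {K K' : Ideal R}
    (h : K ≤ K') (hfin : len K ≠ ⊤) (hl : len K ≤ len K') : K = K' := by
  refine le_antisymm h ?_
  intro s hs
  have h1 := len_col K s
  have h2 : len K' ≤ len (K ⊔ Ideal.span {s}) :=
    len_anti (sup_le h ((Ideal.span_singleton_le_iff_mem _).2 hs))
  have h3 : len (col K s) = 0 := by
    by_contra h0
    have h4 : 1 ≤ len (col K s) := Order.one_le_iff_ne_zero.2 h0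
    have h5 : 1 + len K ≤ len K := by
      conv_rhs => rw [h1]
      exact add_le_add h4 (hl.trans h2)
    lift len K to ℕ using hfin with n
    have : 1 + n ≤ n := by exact_mod_cast h5
    omega
  rw [len_eq_zero] at h3
  have : (1 : R) ∈ col K s := h3 ▸ Submodule.mem_top
  simpa [mem_col] using this

/-- Ideal generated by powers. -/
def powId {R : Type*} [CommRing R] (T : Finset R) (a : R → ℕ) : Ideal R :=
  Ideal.span ((fun i => i ^ a i) '' (T : Set R))

theorem powId_insert {R : Type*} [CommRing R] [DecidableEq R] (T : Finset R) (a : R → ℕ) (j : R) :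
    powId (insert j T) a = powId T a ⊔ Ideal.span {j ^ a j} := by
  rw [powId, powId, Finset.coe_insert, Set.image_insert_eq, Ideal.span_insert, sup_comm]

theorem powId_congr {R : Type*} [CommRing R] {T : Finset R} {a b : R → ℕ} (h : ∀ i ∈ T, a i = b i) :
    powId T a = powId T b := by
  unfold powId
  congr 1
  refine Set.image_congr fun i hi => ?_
  rw [h i hi]

theorem reg_one {R : Type*} [CommRing R] [IsNoetherianRing R] [IsLocalRing R]
    (s : Finset R) (hs : maximalIdeal R = Ideal.span (s : Set R))
    (hd : (s.card : WithBot ℕ∞) ≤ ringKrullDim R)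
    (T : Finset R) (hT : T ⊆ s) (y : R) (hy : y ∈ s) (hyT : y ∉ T) (z : R)
    (hz : y * z ∈ Ideal.span (T : Set R)) : z ∈ Ideal.span (T : Set R) := by
  classical
  set I := Ideal.span (T : Set R) with hI
  have hIm : I ≤ maximalIdeal R := hs ▸ Ideal.span_mono (by exact_mod_cast hT)
  have hne : I ≠ ⊤ := fun h => (maximalIdeal.isMaximal R).ne_top (top_le_iff.1 (h ▸ hIm))
  have : Nontrivial (R ⧸ I) := Ideal.Quotient.nontrivial_iff.2 hne
  have : IsLocalRing (R ⧸ I) := .of_surjective' _ Ideal.Quotient.mk_surjective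
  have hdim : ((s.card - T.card : ℕ) : WithBot ℕ∞) ≤ ringKrullDim (R ⧸ I) := by
    have h1 := ringKrullDim_le_ringKrullDim_quotient_add_card (R := R) T
      (by rw [IsLocalRing.ringJacobson_eq_maximalIdeal]; exact fun t ht => hIm (Ideal.subset_span ht))
    have h2 := hd.trans h1
    have h3 : s.card = (s.card - T.card) + T.card := by
      have := Finset.card_le_card hT; omega
    rw [h3] at h2
    push_cast at h2
    exact (ENat.WithBot.add_le_add_natCast_right_iff).1 h2
  have himg : maximalIdeal (R ⧸ I) = Ideal.span (((s \ T).image (Ideal.Quotient.mk I) : Finset _) : Set (R ⧸ I)) := by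
    have h1 : maximalIdeal R = I ⊔ Ideal.span ((s \ T : Finset R) : Set R) := by
      rw [hs, hI, ← Ideal.span_union]
      congr 1
      ext z; simp only [Finset.mem_coe, Set.mem_union, Finset.mem_sdiff]
      have := @hT z
      tauto
    rw [aux_map_max, h1, Ideal.map_sup, Ideal.map_quotient_self, Ideal.map_span]
    simp
  have hc : (s \ T).card = s.card - T.card := Finset.card_sdiff_of_subset hT
  have hdom := aux_domain (s.card - T.card) _ himg (Finset.card_image_le.trans hc.le) hdim
  have hpr : I.IsPrime := (Ideal.Quotient.isDomain_iff_prime _).1 hdom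
  refine (hpr.mem_or_mem hz).resolve_left fun hyI => ?_
  have himg2 : maximalIdeal (R ⧸ I) = Ideal.span ((((s \ T).erase y).image (Ideal.Quotient.mk I) : Finset _) : Set (R ⧸ I)) := by
    rw [himg]
    refine le_antisymm ?_ (Ideal.span_mono (by
      exact_mod_cast Finset.image_subset_image (Finset.erase_subset _ _)))
    rw [Ideal.span_le]
    intro w hw
    rw [Finset.mem_coe, Finset.mem_image] at hw
    obtain ⟨v, hv, rfl⟩ := hw
    by_cases hvy : v = y
    · rw [hvy, Ideal.Quotient.eq_zero_iff_mem.2 hyI]; exact zero_mem _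
    · exact Ideal.subset_span (Finset.mem_coe.2 (Finset.mem_image_of_mem _ (Finset.mem_erase.2 ⟨hvy, hv⟩)))
  have h5 := aux_dim_le _ himg2
  have h6 := hdim.trans h5
  have h7 : s.card - T.card ≤ (((s \ T).erase y).image (Ideal.Quotient.mk I)).card := by exact_mod_cast h6
  have h8 := h7.trans Finset.card_image_le
  have hyd : y ∈ s \ T := Finset.mem_sdiff.2 ⟨hy, hyT⟩
  rw [Finset.card_erase_of_mem hyd, hc] at h8
  have : 0 < (s \ T).card := Finset.card_pos.2 ⟨y, hyd⟩
  omega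

theorem reg_pow {R : Type*} [CommRing R] [IsNoetherianRing R] [IsLocalRing R]
    (s : Finset R) (hs : maximalIdeal R = Ideal.span (s : Set R))
    (hd : (s.card : WithBot ℕ∞) ≤ ringKrullDim R) (n : ℕ) :
    ∀ (T : Finset R) (_ : T ⊆ s) (a : R → ℕ) (_ : ∀ i ∈ T, 1 ≤ a i) (_ : ∑ i ∈ T, a i = n)
    (y : R) (_ : y ∈ s) (_ : y ∉ T) (z : R)
    (_ : y * z ∈ powId T a), z ∈ powId T a := by
  classical
  induction n using Nat.strong_induction_on with
  | _ n ih =>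
  intro T hT a ha hn y hy hyT z hz
  by_cases hall : ∀ i ∈ T, a i = 1
  · have : powId T a = Ideal.span (T : Set R) := by
      rw [powId_congr (b := fun _ => 1) hall, powId]; simp
    rw [this] at hz ⊢
    exact reg_one s hs hd T hT y hy hyT z hz
  · push Not at hall
    obtain ⟨j, hj, hj1⟩ := hall
    have haj := ha j hj
    obtain ⟨b, hb⟩ : ∃ b, a j = b + 1 := ⟨a j - 1, by omega⟩
    have hb1 : 1 ≤ b := by omega
    obtain ⟨T', hjT', rfl⟩ : ∃ T', j ∉ T' ∧ insert j T' = T :=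
      ⟨T.erase j, Finset.notMem_erase _ _, Finset.insert_erase hj⟩
    have hyT' : y ∉ T' := fun h => hyT (Finset.mem_insert_of_mem h)
    have hT's : T' ⊆ s := (Finset.subset_insert _ _).trans hT
    have hjs : j ∈ s := hT (Finset.mem_insert_self _ _)
    rw [Finset.sum_insert hjT', hb] at hn
    have ha' : ∀ i ∈ T', 1 ≤ a i := fun i hi => ha i (Finset.mem_insert_of_mem hi)
    have hupd : ∀ c, powId (insert j T') (Function.update a j c) = powId T' a ⊔ Ideal.span {j ^ c} := by
      intro c
      rw [powId_insert, Function.update_self, powId_congr (b := a)]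
      intro i hi
      exact Function.update_of_ne (by rintro rfl; exact hjT' hi) _ _
    have IH : ∀ c, 1 ≤ c → c ≤ b → ∀ w, y * w ∈ powId T' a ⊔ Ideal.span {j ^ c} →
        w ∈ powId T' a ⊔ Ideal.span {j ^ c} := by
      intro c hc hcb w hw
      rw [← hupd] at hw ⊢
      refine ih _ ?_ (insert j T') hT _ ?_ rfl y hy hyT w hw
      · rw [Finset.sum_insert hjT', Function.update_self, Finset.sum_congr rfl (g := fun i => a i)]
        · omega
        · intro i hi
          exact Function.update_of_ne (by rintro rfl; exact hjT' hi) _ _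
      · intro i hi
        by_cases hij : i = j
        · rw [hij, Function.update_self]; exact hc
        · rw [Function.update_of_ne hij]; exact ha i hi
    have regj : ∀ c w, j ^ c * w ∈ powId T' a → w ∈ powId T' a := by
      intro c
      induction c with
      | zero => intro w hw; simpa using hw
      | succ c ihc =>
        intro w hw
        refine ihc w (ih _ ?_ T' hT's a ha' rfl j hjs hjT' _ (by rw [pow_succ'] at hw; rwa [mul_assoc] at hw))
        omega
    rw [powId_insert, hb] at hz ⊢
    have h1 : z ∈ powId T' a ⊔ Ideal.span {j ^ b} := IH b hb1 le_rfl z (by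
      have hle : Ideal.span {j ^ (b + 1)} ≤ Ideal.span {j ^ b} := by
        rw [Ideal.span_singleton_le_span_singleton]
        exact pow_dvd_pow _ (Nat.le_succ _)
      exact SetLike.le_def.1 (sup_le_sup_left hle _) hz)
    obtain ⟨k, hk, w', hw', rfl⟩ := Submodule.mem_sup.1 h1
    obtain ⟨w, rfl⟩ := Ideal.mem_span_singleton.1 hw'
    obtain ⟨k2, hk2, v', hv', hkv⟩ := Submodule.mem_sup.1 hz
    obtain ⟨v, rfl⟩ := Ideal.mem_span_singleton.1 hv'
    have h2 : y * w - j * v ∈ powId T' a := by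
      refine regj b _ ?_
      have : j ^ b * (y * w - j * v) = k2 - y * k := by linear_combination -hkv
      rw [this]
      exact sub_mem hk2 (Ideal.mul_mem_left _ _ hk)
    have h3 : w ∈ powId T' a ⊔ Ideal.span {j ^ 1} := by
      refine IH 1 le_rfl hb1 w ?_
      have : y * w = (y * w - j * v) + j ^ 1 * v := by ring
      rw [this]
      exact Submodule.add_mem_sup h2 (Ideal.mul_mem_right _ _ (Ideal.mem_span_singleton_self _))
    obtain ⟨k3, hk3, t', ht', rfl⟩ := Submodule.mem_sup.1 h3
    obtain ⟨t, rfl⟩ := Ideal.mem_span_singleton.1 ht'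
    have : k + j ^ b * (k3 + j ^ 1 * t) = (k + j ^ b * k3) + j ^ (b + 1) * t := by ring
    rw [this]
    exact Submodule.add_mem_sup (add_mem hk (Ideal.mul_mem_left _ _ hk3))
      (Ideal.mul_mem_right _ _ (Ideal.mem_span_singleton_self _))

theorem len_powId {R : Type*} [CommRing R] [IsNoetherianRing R] [IsLocalRing R]
    (s : Finset R) (hs : maximalIdeal R = Ideal.span (s : Set R))
    (hd : (s.card : WithBot ℕ∞) ≤ ringKrullDim R) (n : ℕ) :
    ∀ (a : R → ℕ) (_ : ∀ i ∈ s, 1 ≤ a i) (_ : ∑ i ∈ s, a i = n),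
      len (powId s a) = ((∏ i ∈ s, a i : ℕ) : ℕ∞) := by
  classical
  induction n using Nat.strong_induction_on with
  | _ n ih =>
  intro a ha hn
  by_cases hall : ∀ i ∈ s, a i = 1
  · have : powId s a = Ideal.span (s : Set R) := by
      rw [powId_congr (b := fun _ => 1) hall, powId]; simp
    rw [this, ← hs, len_max, Finset.prod_eq_one hall]; simp
  · push Not at hall
    obtain ⟨j, hj, hj1⟩ := hall
    have haj := ha j hj
    obtain ⟨b, hb⟩ : ∃ b, a j = b + 1 := ⟨a j - 1, by omega⟩
    have hb1 : 1 ≤ b := by omega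
    obtain ⟨T', hjT', hTs⟩ : ∃ T', j ∉ T' ∧ insert j T' = s :=
      ⟨s.erase j, Finset.notMem_erase _ _, Finset.insert_erase hj⟩
    have hT's : T' ⊆ s := hTs ▸ (Finset.subset_insert _ _)
    have ha' : ∀ i ∈ T', 1 ≤ a i := fun i hi => ha i (hT's hi)
    have hsum : ∀ f : R → ℕ, ∑ i ∈ s, f i = f j + ∑ i ∈ T', f i := fun f => by
      rw [← hTs, Finset.sum_insert hjT']
    have hprod : ∀ f : R → ℕ, ∏ i ∈ s, f i = f j * ∏ i ∈ T', f i := fun f => by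
      rw [← hTs, Finset.prod_insert hjT']
    rw [hsum, hb] at hn
    have hupd : ∀ c, powId s (Function.update a j c) = powId T' a ⊔ Ideal.span {j ^ c} := by
      intro c
      rw [← hTs, powId_insert, Function.update_self, powId_congr (b := a)]
      intro i hi
      exact Function.update_of_ne (by rintro rfl; exact hjT' hi) _ _
    have IH : ∀ c, 1 ≤ c → c ≤ b → len (powId T' a ⊔ Ideal.span {j ^ c}) =
        ((c * ∏ i ∈ T', a i : ℕ) : ℕ∞) := by
      intro c hc hcb
      have hcg : ∀ i ∈ T', Function.update a j c i = a i := fun i hi =>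
        Function.update_of_ne (by rintro rfl; exact hjT' hi) _ _
      rw [← hupd, ih _ ?_ _ ?_ rfl]
      · rw [hprod, Function.update_self, Finset.prod_congr rfl (g := fun i => a i) hcg]
      · rw [hsum, Function.update_self, Finset.sum_congr rfl (g := fun i => a i) hcg]
        omega
      · intro i hi
        by_cases hij : i = j
        · rw [hij, Function.update_self]; exact hc
        · rw [Function.update_of_ne hij]; exact ha i hi
    have regj : ∀ c w, j ^ c * w ∈ powId T' a → w ∈ powId T' a := by
      intro c
      induction c with
      | zero => intro w hw; simpa using hw
      | succ c ihc =>
        intro w hw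
        exact ihc w (reg_pow s hs hd _ T' hT's a ha' rfl j hj hjT' _ (by rw [pow_succ'] at hw; rwa [mul_assoc] at hw))
    have hse : powId s a = powId T' a ⊔ Ideal.span {j ^ (b + 1)} := by
      rw [← hTs, powId_insert, hb]
    rw [hse, len_col _ (j ^ b)]
    have h1 : col (powId T' a ⊔ Ideal.span {j ^ (b + 1)}) (j ^ b) = powId T' a ⊔ Ideal.span {j ^ 1} := by
      ext z
      rw [mem_col]
      constructor
      · intro h
        obtain ⟨k2, hk2, v', hv', hkv⟩ := Submodule.mem_sup.1 h
        obtain ⟨v, rfl⟩ := Ideal.mem_span_singleton.1 hv'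
        have h2 : z - j * v ∈ powId T' a := by
          refine regj b _ ?_
          have : j ^ b * (z - j * v) = k2 := by linear_combination -hkv
          rw [this]; exact hk2
        have : z = (z - j * v) + j ^ 1 * v := by ring
        rw [this]
        exact Submodule.add_mem_sup h2 (Ideal.mul_mem_right _ _ (Ideal.mem_span_singleton_self _))
      · intro h
        obtain ⟨k3, hk3, t', ht', rfl⟩ := Submodule.mem_sup.1 h
        obtain ⟨t, rfl⟩ := Ideal.mem_span_singleton.1 ht'
        have : j ^ b * (k3 + j ^ 1 * t) = j ^ b * k3 + j ^ (b + 1) * t := by ring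
        rw [this]
        exact Submodule.add_mem_sup (Ideal.mul_mem_left _ _ hk3)
          (Ideal.mul_mem_right _ _ (Ideal.mem_span_singleton_self _))
    have h2 : powId T' a ⊔ Ideal.span {j ^ (b + 1)} ⊔ Ideal.span {j ^ b} = powId T' a ⊔ Ideal.span {j ^ b} := by
      have hle : Ideal.span {j ^ (b + 1)} ≤ Ideal.span {j ^ b} := by
        rw [Ideal.span_singleton_le_span_singleton]
        exact pow_dvd_pow _ (Nat.le_succ _)
      rw [sup_assoc, sup_eq_right.2 hle]
    rw [h1, h2, IH 1 le_rfl hb1, IH b hb1 le_rfl, hprod, hb, ← Nat.cast_add]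
    congr 1
    ring

theorem len_inf_sup {R : Type*} [CommRing R] (I J : Ideal R) :
    len I + len J = len (I ⊓ J) + len (I ⊔ J) := by
  have h1 : len I + len J = Module.length R ((R ⧸ I) × (R ⧸ J)) := by
    rw [Module.length_prod]; rfl
  rw [h1]
  refine Module.length_eq_add_of_exact
    ((Submodule.mapQ (I ⊓ J) I LinearMap.id inf_le_left).prod
      (Submodule.mapQ (I ⊓ J) J LinearMap.id inf_le_right))
    ((Submodule.mapQ I (I ⊔ J) LinearMap.id le_sup_left).coprod
      (-(Submodule.mapQ J (I ⊔ J) LinearMap.id le_sup_right))) ?_ ?_ ?_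
  · rw [injective_iff_map_eq_zero]
    intro y hy
    obtain ⟨y, rfl⟩ := Submodule.Quotient.mk_surjective _ y
    exact (Submodule.Quotient.mk_eq_zero _).2
      ⟨(Submodule.Quotient.mk_eq_zero I).1 (congrArg Prod.fst hy),
       (Submodule.Quotient.mk_eq_zero J).1 (congrArg Prod.snd hy)⟩
  · intro y
    obtain ⟨y, rfl⟩ := Submodule.Quotient.mk_surjective _ y
    exact ⟨(Submodule.Quotient.mk y, 0), by simp⟩
  · rintro ⟨y, z⟩
    obtain ⟨y, rfl⟩ := Submodule.Quotient.mk_surjective _ y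
    obtain ⟨z, rfl⟩ := Submodule.Quotient.mk_surjective _ z
    constructor
    · intro h
      have h2 : (Submodule.Quotient.mk y : R ⧸ (I ⊔ J)) = Submodule.Quotient.mk z := by
        simpa [← sub_eq_add_neg, sub_eq_zero] using h
      have h3 := (Submodule.Quotient.eq _).1 h2
      obtain ⟨i, hi, j, hj, hij⟩ := Submodule.mem_sup.1 h3
      refine ⟨Submodule.Quotient.mk (y - i), ?_⟩
      refine Prod.ext ?_ ?_
      · refine (Submodule.Quotient.eq I).2 ?_
        simpa using hi
      · refine (Submodule.Quotient.eq J).2 ?_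
        have : y - i - z = j := by linear_combination -hij
        simpa [this] using hj
    · rintro ⟨w, hw⟩
      obtain ⟨w, rfl⟩ := Submodule.Quotient.mk_surjective _ w
      rw [← hw]
      simp

section Frob
variable {R : Type*} [CommRing R] (p : ℕ) [Fact p.Prime] [CharP R p]

/-- Frobenius power of an ideal. -/
def frI (e : ℕ) (I : Ideal R) : Ideal R := I.map (iterateFrobenius R p e)

theorem bracket_eq (e : ℕ) (I : Ideal R) : bracketPow I (p ^ e) = frI p e I := rfl

theorem frI_mono (e : ℕ) {I J : Ideal R} (h : I ≤ J) : frI p e I ≤ frI p e J := Ideal.map_mono h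

theorem frI_sup (e : ℕ) (I J : Ideal R) : frI p e (I ⊔ J) = frI p e I ⊔ frI p e J :=
  Ideal.map_sup _ _ _

theorem frI_span (e : ℕ) (s : Set R) :
    frI p e (Ideal.span s) = Ideal.span ((fun x => x ^ p ^ e) '' s) := Ideal.map_span _ _

theorem frI_singleton (e : ℕ) (r : R) : frI p e (Ideal.span {r}) = Ideal.span {r ^ p ^ e} := by
  rw [frI_span, Set.image_singleton]

theorem pow_mem_frI (e : ℕ) {I : Ideal R} {x : R} (h : x ∈ I) : x ^ p ^ e ∈ frI p e I :=
  Ideal.mem_map_of_mem (iterateFrobenius R p e) h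

theorem frI_le_pow (e : ℕ) (I : Ideal R) (n : ℕ) : frI p e (I ^ n) ≤ I ^ n := by
  refine Ideal.map_le_iff_le_comap.2 fun x hx => ?_
  exact Ideal.pow_mem_of_mem _ hx _ (pow_pos (Fact.out : p.Prime).pos e)

theorem col_le_frI (e : ℕ) (I : Ideal R) (s : R) :
    frI p e (col I s) ≤ col (frI p e I) (s ^ p ^ e) := by
  refine Ideal.map_le_iff_le_comap.2 fun x hx => ?_
  have := pow_mem_frI p e (mem_col.1 hx)
  rw [mul_pow] at this
  exact this

variable [IsNoetherianRing R] [IsLocalRing R]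

theorem frI_primary (e : ℕ) {I : Ideal R} (h : ∃ n, maximalIdeal R ^ n ≤ I) :
    ∃ n, maximalIdeal R ^ n ≤ frI p e I := by
  obtain ⟨n, hn⟩ := h
  have h1 : maximalIdeal R ≤ (frI p e I).radical := by
    intro x hx
    refine ⟨n * p ^ e, ?_⟩
    rw [pow_mul]
    exact pow_mem_frI p e (hn (Ideal.pow_mem_pow hx n))
  obtain ⟨k, hk⟩ := (frI p e I).exists_radical_pow_le_of_fg (IsNoetherian.noetherian _)
  exact ⟨k, (Ideal.pow_right_mono h1 k).trans hk⟩

theorem len_frI_le (e : ℕ) (J' : Ideal R) (n : ℕ) :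
    ∀ J : Ideal R, (∃ N, maximalIdeal R ^ N ≤ J) → J ≤ J' → len J = n →
    len (frI p e J) + len (frI p e (maximalIdeal R)) * len J' ≤
      len (frI p e J') + len (frI p e (maximalIdeal R)) * len J := by
  classical
  induction n with
  | zero =>
    intro J hJ hJJ' hl
    have : J = ⊤ := len_eq_zero.1 (by simpa using hl)
    subst this
    rw [top_le_iff.1 hJJ']
  | succ n ih =>
    intro J hJ hJJ' hl
    by_cases heq : J = J'
    · rw [heq]
    have hnle : ¬ J' ≤ J := fun h => heq (le_antisymm hJJ' h)
    have hex : ∃ N, maximalIdeal R ^ N * J' ≤ J := by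
      obtain ⟨N, hN⟩ := hJ
      exact ⟨N, Ideal.mul_le_left.trans hN⟩
    obtain ⟨N, hN⟩ : ∃ N, Nat.find hex = N + 1 := by
      refine Nat.exists_eq_succ_of_ne_zero fun h0 => hnle ?_
      have := Nat.find_spec hex
      rw [h0] at this
      simpa using this
    have h1 := Nat.find_spec hex
    rw [hN] at h1
    have h2 : ¬ maximalIdeal R ^ N * J' ≤ J := Nat.find_min hex (by omega)
    obtain ⟨r, hr, hrJ⟩ := SetLike.not_le_iff_exists.1 h2
    have hmr : maximalIdeal R ≤ col J r := by
      intro x hx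
      rw [mem_col, mul_comm]
      refine h1 ?_
      rw [pow_succ', mul_assoc]
      exact Ideal.mul_mem_mul hx hr
    have hrJ' : r ∈ J' := Ideal.mul_le_right hr
    have hcol : col J r = maximalIdeal R := by
      refine ((maximalIdeal.isMaximal R).eq_of_le ?_ hmr).symm
      intro h
      have : (1 : R) ∈ col J r := h ▸ Submodule.mem_top
      exact hrJ (by simpa [mem_col] using this)
    have h3 := len_col J r
    rw [hcol, len_max, hl] at h3
    have h4 : len (J ⊔ Ideal.span {r}) = n := by
      have hh : ((n + 1 : ℕ) : ℕ∞) = 1 + n := by push_cast; ring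
      rw [hh] at h3
      exact (ENat.add_right_injective_of_ne_top (n := 1) (by simp) h3).symm
    have h5 := ih (J ⊔ Ideal.span {r}) (hJ.imp fun N h => h.trans le_sup_left)
      (sup_le hJJ' ((Ideal.span_singleton_le_iff_mem _).2 hrJ')) h4
    have h6 := len_col (frI p e J) (r ^ p ^ e)
    rw [← frI_singleton, ← frI_sup] at h6
    have h7 : len (col (frI p e J) (r ^ p ^ e)) ≤ len (frI p e (maximalIdeal R)) := by
      refine len_anti ?_
      rw [← hcol]
      exact col_le_frI p e J r
    rw [h6, hl]
    rw [h4] at h5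
    set c := len (frI p e (maximalIdeal R))
    calc _ ≤ c + len (frI p e (J ⊔ Ideal.span {r})) + c * len J' := by gcongr
      _ = c + (len (frI p e (J ⊔ Ideal.span {r})) + c * len J') := by ring
      _ ≤ c + (len (frI p e J') + c * n) := by gcongr
      _ = _ := by push_cast; ring


theorem len_powId_const (s : Finset R) (hs : maximalIdeal R = Ideal.span (s : Set R))
    (hd : (s.card : WithBot ℕ∞) ≤ ringKrullDim R)
    (N : ℕ) (hN : 1 ≤ N) :
    len (powId s (fun _ => N)) = ((N ^ s.card : ℕ) : ℕ∞) := by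
  rw [len_powId s hs hd _ (fun _ => N) (fun _ _ => hN) rfl]
  simp

theorem len_frI_max (s : Finset R) (hs : maximalIdeal R = Ideal.span (s : Set R))
    (hd : (s.card : WithBot ℕ∞) ≤ ringKrullDim R)
    (e : ℕ) :
    len (frI p e (maximalIdeal R)) = (((p ^ e) ^ s.card : ℕ) : ℕ∞) := by
  rw [hs, frI_span, ← len_powId_const s hs hd (p ^ e) (Nat.one_le_pow _ _ (Fact.out : p.Prime).pos)]
  rfl

theorem len_frI (s : Finset R) (hs : maximalIdeal R = Ideal.span (s : Set R))
    (hd : (s.card : WithBot ℕ∞) ≤ ringKrullDim R)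
    (e : ℕ) (K : Ideal R) (hK : ∃ n, maximalIdeal R ^ n ≤ K) :
    len (frI p e K) = (((p ^ e) ^ s.card : ℕ) : ℕ∞) * len K := by
  have hpos : 1 ≤ p ^ e := Nat.one_le_pow _ _ (Fact.out : p.Prime).pos
  obtain ⟨n, hn⟩ := hK
  have hK1 := len_ne_top hn
  obtain ⟨l, hl⟩ := ENat.ne_top_iff_exists.1 hK1
  have hup := len_frI_le p e (⊤ : Ideal R) l K ⟨n, hn⟩ le_top hl.symm
  have ht : len (⊤ : Ideal R) = 0 := len_eq_zero.2 rfl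
  have ht2 : frI p e (⊤ : Ideal R) = ⊤ := Ideal.map_top _
  rw [ht2, ht, mul_zero, add_zero, zero_add, len_frI_max p s hs hd] at hup
  refine le_antisymm hup ?_
  -- lower bound
  set N := n + 1
  set L := powId s (fun _ => N) with hL
  have hLm : L ≤ K := by
    refine le_trans ?_ hn
    rw [hL, powId, Ideal.span_le]
    rintro _ ⟨x, hx, rfl⟩
    have hxm : x ∈ maximalIdeal R := hs ▸ Ideal.subset_span hx
    exact Ideal.pow_le_pow_right (Nat.le_succ n) (Ideal.pow_mem_pow hxm N)
  have hLp : ∃ k, maximalIdeal R ^ k ≤ L := by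
    have h1 : maximalIdeal R ≤ L.radical := by
      conv_lhs => rw [hs]
      rw [Ideal.span_le]
      intro x hx
      exact ⟨N, Ideal.subset_span ⟨x, hx, rfl⟩⟩
    obtain ⟨k, hk⟩ := L.exists_radical_pow_le_of_fg (IsNoetherian.noetherian _)
    exact ⟨k, (Ideal.pow_right_mono h1 k).trans hk⟩
  have hlL : len L = ((N ^ s.card : ℕ) : ℕ∞) := len_powId_const s hs hd N (by omega)
  have hfrL : len (frI p e L) = (((N * p ^ e) ^ s.card : ℕ) : ℕ∞) := by
    rw [← len_powId_const s hs hd (N * p ^ e) (Nat.mul_pos (by omega) hpos), hL, powId, frI_span,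
      Set.image_image, powId]
    simp only [pow_mul]
  have hlow := len_frI_le p e K _ L hLp hLm hlL
  rw [hfrL, hlL, len_frI_max p s hs hd, ← hl] at hlow
  rw [← hl]
  obtain ⟨f, hf⟩ := ENat.ne_top_iff_exists.1 (ne_top_of_le_ne_top (by rw [← hl]; exact_mod_cast ENat.natCast_ne_top _) hup)
  rw [← hf] at hlow ⊢
  have h8 : (N * p ^ e) ^ s.card + (p ^ e) ^ s.card * l ≤ f + (p ^ e) ^ s.card * N ^ s.card := by
    exact_mod_cast hlow
  have h9 : (p ^ e) ^ s.card * l ≤ f := by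
    rw [mul_pow, mul_comm (N ^ s.card)] at h8
    omega
  exact_mod_cast h9

theorem col_frI_primary (s : Finset R) (hs : maximalIdeal R = Ideal.span (s : Set R))
    (hd : (s.card : WithBot ℕ∞) ≤ ringKrullDim R)
    (e : ℕ) (I : Ideal R) (r : R) (hI : ∃ n, maximalIdeal R ^ n ≤ I) :
    frI p e (col I r) = col (frI p e I) (r ^ p ^ e) := by
  have hIc : ∃ n, maximalIdeal R ^ n ≤ col I r :=
    hI.imp fun n h => h.trans fun x hx => Ideal.mul_mem_left _ _ hx
  have hIs : ∃ n, maximalIdeal R ^ n ≤ I ⊔ Ideal.span {r} := hI.imp fun n h => h.trans le_sup_left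
  obtain ⟨k, hk⟩ := frI_primary p e hIc
  refine eq_of_len (col_le_frI p e I r) (len_ne_top hk) ?_
  have h1 := len_col I r
  have h2 := len_col (frI p e I) (r ^ p ^ e)
  rw [← frI_singleton, ← frI_sup, len_frI p s hs hd e _ hI, len_frI p s hs hd e _ hIs, h1, mul_add] at h2
  rw [len_frI p s hs hd e _ hIc]
  have hfin : len (frI p e (I ⊔ Ideal.span {r})) ≠ ⊤ := by
    obtain ⟨k, hk⟩ := frI_primary p e hIs
    exact len_ne_top hk
  rw [len_frI p s hs hd e _ hIs] at hfin
  exact (ENat.add_left_injective_of_ne_top hfin h2).le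

theorem inf_frI_primary (s : Finset R) (hs : maximalIdeal R = Ideal.span (s : Set R))
    (hd : (s.card : WithBot ℕ∞) ≤ ringKrullDim R)
    (e : ℕ) (I J : Ideal R) (hI : ∃ n, maximalIdeal R ^ n ≤ I)
    (hJ : ∃ n, maximalIdeal R ^ n ≤ J) :
    frI p e (I ⊓ J) = frI p e I ⊓ frI p e J := by
  have hIJ : ∃ n, maximalIdeal R ^ n ≤ I ⊓ J := by
    obtain ⟨n, hn⟩ := hI
    obtain ⟨k, hk⟩ := hJ
    exact ⟨n + k, le_inf ((Ideal.pow_le_pow_right (by omega)).trans hn)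
      ((Ideal.pow_le_pow_right (by omega)).trans hk)⟩
  have hIs : ∃ n, maximalIdeal R ^ n ≤ I ⊔ J := hI.imp fun n h => h.trans le_sup_left
  obtain ⟨k, hk⟩ := frI_primary p e hIJ
  refine eq_of_len (le_inf (frI_mono p e inf_le_left) (frI_mono p e inf_le_right)) (len_ne_top hk) ?_
  have h1 := len_inf_sup I J
  have h2 := len_inf_sup (frI p e I) (frI p e J)
  rw [← frI_sup, len_frI p s hs hd e _ hI, len_frI p s hs hd e _ hJ, len_frI p s hs hd e _ hIs,
    ← mul_add, h1, mul_add] at h2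
  rw [len_frI p s hs hd e _ hIJ]
  have hfin : len (frI p e (I ⊔ J)) ≠ ⊤ := by
    obtain ⟨k, hk⟩ := frI_primary p e hIs
    exact len_ne_top hk
  rw [len_frI p s hs hd e _ hIs] at hfin
  exact (ENat.add_left_injective_of_ne_top hfin h2).le

end Frob

theorem mem_of_forall_sup_pow {R : Type*} [CommRing R] [IsNoetherianRing R] [IsLocalRing R]
    (I : Ideal R) (x : R) (h : ∀ n, x ∈ I ⊔ maximalIdeal R ^ n) : x ∈ I := by
  have h1 : (Submodule.Quotient.mk x : R ⧸ I) = 0 := by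
    refine IsHausdorff.haus (inferInstance : IsHausdorff (maximalIdeal R) (R ⧸ I)) _ fun n => ?_
    rw [SModEq.zero]
    obtain ⟨i, hi, y, hy, rfl⟩ := Submodule.mem_sup.1 (h n)
    have : (Submodule.Quotient.mk (i + y) : R ⧸ I) = y • (Submodule.Quotient.mk (1 : R) : R ⧸ I) := by
      rw [← Submodule.Quotient.mk_smul]
      refine (Submodule.Quotient.eq _).2 ?_
      simpa using hi
    rw [this]
    exact Submodule.smul_mem_smul hy Submodule.mem_top
  exact (Submodule.Quotient.mk_eq_zero _).1 h1

theorem chevalley {R : Type*} [CommRing R] [IsNoetherianRing R] [IsLocalRing R]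
    [IsAdicComplete (maximalIdeal R) R] (T : Set (Ideal R)) (hT : T.Nonempty)
    (hinf : ∀ K ∈ T, ∀ K' ∈ T, K ⊓ K' ∈ T) (n : ℕ) :
    ∃ K ∈ T, K ≤ sInf T ⊔ maximalIdeal R ^ n := by
  have hmin : ∀ j : ℕ, ∃ K ∈ T, ∀ K' ∈ T, K ≤ K' ⊔ maximalIdeal R ^ j := by
    intro j
    have : IsArtinianRing (R ⧸ maximalIdeal R ^ j) := by
      by_cases hK : maximalIdeal R ^ j = ⊤
      · have : Subsingleton (R ⧸ maximalIdeal R ^ j) := Ideal.Quotient.subsingleton_iff.2 hK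
        infer_instance
      refine IsLocalRing.quotient_artinian_of_mem_minimalPrimes_of_isLocalRing _ ?_
      refine ⟨⟨inferInstance, le_maximalIdeal hK⟩, ?_⟩
      rintro q ⟨hq, hKq⟩ -
      exact hq.le_of_pow_le hKq
    let f : Ideal R → Ideal (R ⧸ maximalIdeal R ^ j) := Ideal.map (Ideal.Quotient.mk _)
    obtain ⟨_, ⟨K, hK, rfl⟩, hmin⟩ := (wellFounded_lt (α := Ideal (R ⧸ maximalIdeal R ^ j))).has_min
      (f '' T) (hT.image f)
    refine ⟨K, hK, fun K' hK' x hx => ?_⟩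
    have h1 : f (K ⊓ K') = f K := by
      have hle : f (K ⊓ K') ≤ f K := Ideal.map_mono inf_le_left
      exact eq_of_le_of_not_lt hle (hmin _ ⟨_, hinf K hK K' hK', rfl⟩)
    have h2 : Ideal.Quotient.mk _ x ∈ f (K ⊓ K') := by
      rw [h1]; exact Ideal.mem_map_of_mem _ hx
    obtain ⟨y, hy, hyx⟩ := (Ideal.mem_map_iff_of_surjective _ Ideal.Quotient.mk_surjective).1 h2
    have h3 := Ideal.Quotient.eq.1 hyx
    have : x = y - (y - x) := by ring
    rw [this]
    exact sub_mem (Ideal.mem_sup_left hy.2) (Ideal.mem_sup_right h3)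
  choose K hK hKmin using hmin
  refine ⟨K n, hK n, fun x hx => ?_⟩
  set m := maximalIdeal R with hm
  have hstep : ∀ (j : ℕ) (y : {y : R // y ∈ K j ⊔ m ^ j}), ∃ z : {z : R // z ∈ K (j+1) ⊔ m ^ (j+1)},
      (y : R) - z ∈ m ^ j := by
    rintro j ⟨y, hy⟩
    obtain ⟨k, hk, w, hw, rfl⟩ := Submodule.mem_sup.1 hy
    obtain ⟨z, hz, v, hv, rfl⟩ := Submodule.mem_sup.1 (hKmin j (K (j+1)) (hK (j+1)) hk)
    refine ⟨⟨z, Ideal.mem_sup_left hz⟩, ?_⟩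
    have : z + v + w - z = v + w := by ring
    change z + v + w - z ∈ _
    rw [this]
    exact add_mem hv hw
  choose g hg using hstep
  let F : (j : ℕ) → {y : R // y ∈ K (n + j) ⊔ m ^ (n + j)} := fun j =>
    Nat.rec ⟨x, Ideal.mem_sup_left hx⟩ (fun j y => g (n + j) y) j
  have hF : ∀ j, (F j).1 - (F (j+1)).1 ∈ m ^ (n + j) := by
    intro j
    exact hg (n + j) (F j)
  have hF2 : ∀ j d, (F j).1 - (F (j + d)).1 ∈ m ^ (n + j) := by
    intro j d
    induction d with
    | zero => simp
    | succ d ih =>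
      have h1 : (F j).1 - (F (j + (d + 1))).1 = ((F j).1 - (F (j + d)).1) + ((F (j + d)).1 - (F (j + d + 1)).1) := by
        change (F j).1 - (F (j + d + 1)).1 = _
        ring
      rw [h1]
      exact add_mem ih (Ideal.pow_le_pow_right (by omega) (hF (j + d)))
  obtain ⟨L, hL⟩ := IsPrecomplete.prec (I := m) (M := R) inferInstance (f := fun j => (F j).1) (by
    intro a b hab
    obtain ⟨d, rfl⟩ := Nat.exists_eq_add_of_le hab
    rw [SModEq.sub_mem]
    simpa using Ideal.pow_le_pow_right (Nat.le_add_left a n) (hF2 a d))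
  have hL' : ∀ j, (F j).1 - L ∈ m ^ j := by
    intro j
    have := hL j
    rw [SModEq.sub_mem] at this
    simpa using this
  have hLT : L ∈ sInf T := by
    rw [Submodule.mem_sInf]
    intro K' hK'
    refine mem_of_forall_sup_pow K' L fun j => ?_
    have h1 : (F j).1 ∈ K' ⊔ m ^ j := by
      refine SetLike.le_def.1 (sup_le ((hKmin (n + j) K' hK').trans ?_) ?_) (F j).2
      · exact sup_le_sup_left (Ideal.pow_le_pow_right (by omega)) _
      · exact le_sup_of_le_right (Ideal.pow_le_pow_right (by omega))
    have : L = (F j).1 - ((F j).1 - L) := by ring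
    rw [this]
    exact sub_mem h1 (Ideal.mem_sup_right (hL' j))
  have hx0 : (F 0).1 = x := rfl
  have : x = L + (((F 0).1 - (F (0 + n)).1) + ((F n).1 - L)) := by rw [zero_add, hx0]; ring
  rw [this]
  exact Submodule.add_mem_sup hLT (add_mem (hF2 0 n) (hL' n))

section Main
variable {R : Type*} [CommRing R] (p : ℕ) [Fact p.Prime] [CharP R p]
  [IsNoetherianRing R] [IsLocalRing R] [IsAdicComplete (maximalIdeal R) R]

theorem mem_frI_of_forall (e : ℕ) (I : Ideal R) (x : R)
    (h : ∀ n, x ∈ frI p e (I ⊔ maximalIdeal R ^ n)) : x ∈ frI p e I := by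
  refine mem_of_forall_sup_pow _ _ fun n => ?_
  have := h n
  rw [frI_sup] at this
  exact SetLike.le_def.1 (sup_le_sup_left (frI_le_pow p e _ n) _) this

theorem condStar (s : Finset R) (hs : maximalIdeal R = Ideal.span (s : Set R))
    (hd : (s.card : WithBot ℕ∞) ≤ ringKrullDim R)
    (e : ℕ) (a : Ideal R) : a ≤ frI p e (Ie p a e) := by
  set T : Set (Ideal R) := {K | (∃ n, maximalIdeal R ^ n ≤ K) ∧ a ≤ frI p e K} with hT
  have hle : sInf T ≤ Ie p a e := by
    refine le_sInf fun I hI x hx => mem_of_forall_sup_pow I x fun n => ?_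
    refine (Submodule.mem_sInf.1 hx) _ ⟨⟨n, le_sup_right⟩, ?_⟩
    exact le_trans (show a ≤ frI p e I from hI) (frI_mono p e le_sup_left)
  refine le_trans ?_ (frI_mono p e hle)
  intro x hx
  refine mem_frI_of_forall p e _ x fun n => ?_
  obtain ⟨K, hK, hKle⟩ := chevalley T ⟨⊤, ⟨0, le_top⟩, by rw [frI, Ideal.map_top]; exact le_top⟩
    (by
      rintro K ⟨⟨n, hn⟩, hK⟩ K' ⟨⟨n', hn'⟩, hK'⟩
      refine ⟨⟨n + n', le_inf ((Ideal.pow_le_pow_right (by omega)).trans hn)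
        ((Ideal.pow_le_pow_right (by omega)).trans hn')⟩, ?_⟩
      rw [inf_frI_primary p s hs hd e K K' ⟨n, hn⟩ ⟨n', hn'⟩]
      exact le_inf hK hK') n
  exact frI_mono p e hKle (hK.2 hx)

theorem Ie_le_iff (s : Finset R) (hs : maximalIdeal R = Ideal.span (s : Set R))
    (hd : (s.card : WithBot ℕ∞) ≤ ringKrullDim R)
    (e : ℕ) (a I : Ideal R) : Ie p a e ≤ I ↔ a ≤ frI p e I :=
  ⟨fun h => (condStar p s hs hd e a).trans (frI_mono p e h), fun h => sInf_le h⟩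

theorem col_frI (s : Finset R) (hs : maximalIdeal R = Ideal.span (s : Set R))
    (hd : (s.card : WithBot ℕ∞) ≤ ringKrullDim R)
    (e : ℕ) (I : Ideal R) (r x : R) (h : r ^ p ^ e * x ∈ frI p e I) :
    x ∈ frI p e (col I r) := by
  have h1 : Ie p (Ideal.span {x}) e ≤ col I r := by
    intro z hz
    rw [mem_col]
    refine mem_of_forall_sup_pow I _ fun n => ?_
    rw [← mem_col]
    refine SetLike.le_def.1 ((Ie_le_iff p s hs hd e _ _).2 ?_) hz
    rw [Ideal.span_singleton_le_iff_mem, col_frI_primary p s hs hd e _ r ⟨n, le_sup_right⟩, mem_col]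
    exact frI_mono p e le_sup_left h
  rw [Ie_le_iff p s hs hd, Ideal.span_singleton_le_iff_mem] at h1
  exact h1

end Main

/-- The colon ideal `(I : J)`. -/
def colI {R : Type*} [CommRing R] (I J : Ideal R) : Ideal R where
  carrier := {x | ∀ y ∈ J, x * y ∈ I}
  add_mem' := fun ha hb y hy => by
    rw [add_mul]
    exact add_mem (ha y hy) (hb y hy)
  zero_mem' := fun y _ => by simp
  smul_mem' := fun c x hx y hy => by
    rw [smul_eq_mul, mul_assoc]
    exact Ideal.mul_mem_left _ _ (hx y hy)

theorem mem_colI {R : Type*} [CommRing R] {I J : Ideal R} {x : R} :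
    x ∈ colI I J ↔ ∀ y ∈ J, x * y ∈ I := Iff.rfl

theorem artin_chain {A : Type*} [CommRing A] [IsNoetherianRing A] (I : Ideal A)
    [IsArtinianRing (A ⧸ I)] (K : ℕ → Ideal A) (hK : Antitone K)
    (hI : ∀ e, I * K 0 ≤ K e) : ∃ e, K (e + 1) = K e := by
  let M := (K 0) ⧸ (I • (⊤ : Submodule A (K 0)))
  have hfin : Module.Finite (A ⧸ I) M := Module.Finite.of_restrictScalars_finite A (A ⧸ I) M
  have hart : IsArtinian (A ⧸ I) M := inferInstance
  have hartA : IsArtinian A M := by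
    have hsurj : Function.Surjective (algebraMap A (A ⧸ I)) := Ideal.Quotient.mk_surjective
    exact (Submodule.orderIsoOfAlgebraMapSurjective (M := M) hsurj).symm.toOrderEmbedding.wellFoundedLT
  let f : ℕ →o (Submodule A M)ᵒᵈ :=
    { toFun := fun e => OrderDual.toDual
        ((Submodule.comap (K 0).subtype (K e)).map (Submodule.mkQ (I • (⊤ : Submodule A (K 0)))))
      monotone' := fun i j h => Submodule.map_mono (Submodule.comap_mono (hK h)) }
  obtain ⟨e, he⟩ := IsArtinian.monotone_stabilizes f
  refine ⟨e, le_antisymm (hK (Nat.le_succ e)) fun x hx => ?_⟩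
  have h1 : (Submodule.comap (K 0).subtype (K e)).map (Submodule.mkQ (I • (⊤ : Submodule A (K 0)))) =
    (Submodule.comap (K 0).subtype (K (e+1))).map (Submodule.mkQ (I • (⊤ : Submodule A (K 0)))) :=
    he (e + 1) (Nat.le_succ e)
  have hx0 : x ∈ K 0 := hK (Nat.zero_le e) hx
  have h2 : Submodule.mkQ (I • (⊤ : Submodule A (K 0))) ⟨x, hx0⟩ ∈
      (Submodule.comap (K 0).subtype (K e)).map (Submodule.mkQ (I • (⊤ : Submodule A (K 0)))) :=
    Submodule.mem_map_of_mem hx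
  rw [h1] at h2
  obtain ⟨y, hy, hyx⟩ := h2
  have h3 := (Submodule.Quotient.eq _).1 hyx
  have h4 : (K 0).subtype (y - ⟨x, hx0⟩) ∈ (I • (⊤ : Submodule A (K 0))).map (K 0).subtype :=
    Submodule.mem_map_of_mem h3
  rw [Submodule.map_smul'', Submodule.map_top, Submodule.range_subtype] at h4
  have h5 : (y : A) - x ∈ K (e + 1) := hI (e + 1) h4
  have : x = y - (y - x) := by ring
  rw [this]
  exact sub_mem hy h5

theorem gabber {R : Type*} [CommRing R] [IsNoetherianRing R] (q : ℕ) (hq : 2 ≤ q)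
    (φ : Ideal R → Ideal R) (hmono : Monotone φ)
    (hφ : ∀ (r : R) (J K : Ideal R), (∀ x ∈ J, r ^ q * x ∈ K) → ∀ x ∈ φ J, r * x ∈ φ K) :
    ∃ e0, ∀ e, e0 ≤ e → φ^[e] ⊤ = φ^[e0] ⊤ := by
  set J : ℕ → Ideal R := fun e => φ^[e] ⊤ with hJ
  have hJs : ∀ e, J (e + 1) = φ (J e) := fun e => Function.iterate_succ_apply' φ e ⊤
  have hanti : Antitone J := by
    refine antitone_nat_of_succ_le fun e => ?_
    induction e with
    | zero => exact le_top
    | succ e ih =>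
      have h2 := hmono ih
      rwa [← hJs, ← hJs] at h2
  let C : ℕ →o Ideal R :=
    { toFun := fun e => colI (J (e + 1)) (J e)
      monotone' := by
        refine monotone_nat_of_le_succ fun e x hx => ?_
        rw [mem_colI, hJs e, hJs (e + 1)]
        refine hφ x _ _ fun y hy => ?_
        obtain ⟨k, rfl⟩ : ∃ k, q = k + 1 := ⟨q - 1, by omega⟩
        rw [pow_succ, mul_assoc]
        exact Ideal.mul_mem_left _ _ (hx y hy) }
  obtain ⟨e0, he0⟩ := monotone_stabilizes_iff_noetherian.2 ‹IsNoetherian R R› C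
  have hCe : ∀ e, e0 ≤ e → colI (J (e + 1)) (J e) = C e0 := fun e he => (he0 e he).symm
  by_cases htop : C e0 = ⊤
  · refine ⟨e0, fun e he => ?_⟩
    change J e = J e0
    induction e, he using Nat.le_induction with
    | base => rfl
    | succ e he ih =>
      refine le_antisymm (hanti (he.trans (Nat.le_succ e))) ?_
      rw [← ih]
      intro x hx
      have h1 : (1 : R) ∈ colI (J (e + 1)) (J e) := by
        rw [hCe e he, htop]; exact Submodule.mem_top
      simpa using h1 x hx
  exfalso
  have hkey : ∀ e, e0 ≤ e → (C e0) ^ 2 * J e0 ≤ J e := by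
    intro e he
    induction e, he using Nat.le_induction with
    | base => exact Ideal.mul_le_right
    | succ e he ih =>
      rw [pow_two, mul_assoc, Ideal.mul_le]
      intro r hr y hy
      have hy2 : y ∈ φ (J e0) := by
        rw [← hJs]
        refine (Ideal.mul_le.2 ?_) hy
        intro c hc z hz
        exact hc z hz
      rw [hJs]
      refine hφ r _ _ (fun x hx => ih ?_) y hy2
      exact Ideal.mul_mem_mul (Ideal.pow_le_pow_right hq (Ideal.pow_mem_pow hr q)) hx
  obtain ⟨P, hP⟩ := Ideal.nonempty_minimalPrimes htop
  have hPp : P.IsPrime := hP.1.1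
  let A := Localization.AtPrime P
  have hart : IsArtinianRing (A ⧸ ((C e0) ^ 2).map (algebraMap R A)) := by
    refine IsLocalRing.quotient_artinian_of_mem_minimalPrimes_of_isLocalRing _ ?_
    rw [IsLocalization.minimalPrimes_map P.primeCompl A, Set.mem_preimage]
    rw [IsLocalization.AtPrime.under_maximalIdeal A P]
    exact ⟨⟨hPp, (Ideal.pow_le_self two_ne_zero).trans hP.1.2⟩,
      fun Q hQ hQP => hP.2 ⟨hQ.1, hQ.1.le_of_pow_le hQ.2⟩ hQP⟩
  have hnoeth : IsNoetherianRing A := IsLocalization.isNoetherianRing P.primeCompl A ‹_›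
  obtain ⟨e, he⟩ := artin_chain (((C e0) ^ 2).map (algebraMap R A))
    (fun e => (J (e0 + e)).map (algebraMap R A))
    (fun i j h => Ideal.map_mono (hanti (by omega)))
    (fun e => by
      rw [← Ideal.map_mul]
      exact Ideal.map_mono (hkey _ (by omega)))
  have hel : ∀ x ∈ J (e0 + e), ∃ s ∈ P.primeCompl, s * x ∈ J (e0 + e + 1) := by
    intro x hx
    have h1 : algebraMap R A x ∈ (J (e0 + (e + 1))).map (algebraMap R A) := by
      rw [he]; exact Ideal.mem_map_of_mem _ hx
    obtain ⟨⟨y, t⟩, hyt⟩ := (IsLocalization.mem_map_algebraMap_iff P.primeCompl A).1 h1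
    rw [← map_mul] at hyt
    obtain ⟨c, hc⟩ := (IsLocalization.eq_iff_exists P.primeCompl A).1 hyt
    refine ⟨c * t, mul_mem c.2 t.2, ?_⟩
    have : (c : R) * t * x = c * y := by rw [← hc]; ring
    rw [this]
    exact Ideal.mul_mem_left _ _ y.2
  obtain ⟨G, hG⟩ := (IsNoetherian.noetherian (J (e0 + e)) : (J (e0 + e)).FG)
  have hun : ∀ T : Finset R, (T : Set R) ⊆ J (e0 + e) →
      ∃ s ∈ P.primeCompl, ∀ x ∈ T, s * x ∈ J (e0 + e + 1) := by
    classical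
    intro T
    induction T using Finset.induction_on with
    | empty => exact fun _ => ⟨1, one_mem _, by simp⟩
    | insert x T hx ih =>
      intro hT
      rw [Finset.coe_insert, Set.insert_subset_iff] at hT
      obtain ⟨s, hs, hsT⟩ := ih hT.2
      obtain ⟨t, ht, htx⟩ := hel x hT.1
      refine ⟨s * t, mul_mem hs ht, fun y hy => ?_⟩
      rcases Finset.mem_insert.1 hy with rfl | hy
      · rw [mul_assoc]; exact Ideal.mul_mem_left _ _ htx
      · rw [mul_comm s, mul_assoc]; exact Ideal.mul_mem_left _ _ (hsT y hy)
  obtain ⟨s, hs, hsG⟩ := hun G (hG ▸ Submodule.subset_span)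
  have hsC : s ∈ colI (J (e0 + e + 1)) (J (e0 + e)) := by
    have hle : J (e0 + e) ≤ col (J (e0 + e + 1)) s := by
      rw [← hG, Submodule.span_le]
      exact fun x hx => mem_col.2 (hsG x hx)
    exact fun y hy => mem_col.1 (hle hy)
  rw [hCe _ (by omega)] at hsC
  exact hs (hP.1.2 hsC)

section Main2
variable {R : Type*} [CommRing R] (p : ℕ) [Fact p.Prime] [CharP R p]

theorem frI_add (e f : ℕ) (I : Ideal R) : frI p (e + f) I = frI p e (frI p f I) := by
  rw [frI, frI, frI, Ideal.map_map]
  congr 1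
  ext x
  simp only [iterateFrobenius_def, pow_add, RingHom.comp_apply]
  rw [← pow_mul, mul_comm]

variable [IsNoetherianRing R] [IsLocalRing R] [IsAdicComplete (maximalIdeal R) R]

theorem Ie_mono (s : Finset R) (hs : maximalIdeal R = Ideal.span (s : Set R))
    (hd : (s.card : WithBot ℕ∞) ≤ ringKrullDim R)
    (e : ℕ) {a b : Ideal R} (h : a ≤ b) : Ie p a e ≤ Ie p b e :=
  (Ie_le_iff p s hs hd e a _).2 (h.trans (condStar p s hs hd e b))

theorem pow_mem_frI_iff (s : Finset R) (hs : maximalIdeal R = Ideal.span (s : Set R))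
    (hd : (s.card : WithBot ℕ∞) ≤ ringKrullDim R)
    (f : ℕ) (K : Ideal R) (x : R) : x ^ p ^ f ∈ frI p f K ↔ x ∈ K := by
  refine ⟨fun h => ?_, pow_mem_frI p f⟩
  have h1 : (1 : R) ∈ frI p f (col K x) := col_frI p s hs hd f K x 1 (by simpa using h)
  by_cases ht : col K x = ⊤
  · have h2 : (1 : R) ∈ col K x := ht ▸ Submodule.mem_top
    simpa [mem_col] using h2
  · exfalso
    have h2 := frI_mono p f (le_maximalIdeal ht) h1
    have h3 := frI_le_pow p f (maximalIdeal R) 1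
    rw [pow_one] at h3
    exact (Ideal.ne_top_iff_one _).1 (maximalIdeal.isMaximal R).ne_top (h3 h2)

theorem Ie_iterate (s : Finset R) (hs : maximalIdeal R = Ideal.span (s : Set R))
    (hd : (s.card : WithBot ℕ∞) ≤ ringKrullDim R)
    (g : R) (a β e : ℕ) :
    Ie p (Ideal.span {g ^ (a * ∑ i ∈ Finset.range e, (p ^ β) ^ i)}) (β * e) =
      (fun J : Ideal R => Ie p (Ideal.span {g ^ a} * J) β)^[e] ⊤ := by
  induction e with
  | zero =>
    refine eq_of_forall_ge_iff fun I => ?_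
    rw [Ie_le_iff p s hs hd, Ideal.span_singleton_le_iff_mem]
    have h0 := pow_mem_frI_iff p s hs hd 0 I 1
    simp only [one_pow] at h0
    simp only [Finset.range_zero, Finset.sum_empty, mul_zero, pow_zero, Function.iterate_zero, id,
      top_le_iff, h0, Ideal.eq_top_iff_one]
  | succ e ih =>
    refine eq_of_forall_ge_iff fun I => ?_
    rw [Function.iterate_succ_apply', Ie_le_iff p s hs hd, Ie_le_iff p s hs hd, ← ih,
      Ideal.span_singleton_le_iff_mem, Finset.sum_range_succ, Nat.mul_succ, mul_add, pow_add,
      frI_add, pow_mul g a ((p ^ β) ^ e), ← pow_mul p β e]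
    set x := g ^ (a * ∑ i ∈ Finset.range e, (p ^ β) ^ i)
    have h1 : x * (g ^ a) ^ p ^ (β * e) ∈ frI p (β * e) (frI p β I) ↔
        x ∈ frI p (β * e) (col (frI p β I) (g ^ a)) := by
      constructor
      · intro h
        rw [mul_comm x] at h
        exact col_frI p s hs hd _ _ _ _ h
      · intro h
        rw [mul_comm x]
        exact mem_col.1 (col_le_frI p _ _ _ h)
    rw [h1, ← Ideal.span_singleton_le_iff_mem, ← Ie_le_iff p s hs hd, Ideal.span_singleton_mul_le_iff]
    rfl

theorem stab (s : Finset R) (hs : maximalIdeal R = Ideal.span (s : Set R))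
    (hd : (s.card : WithBot ℕ∞) ≤ ringKrullDim R)
    (g : R) (a β : ℕ) (hβ : 1 ≤ β) : ∃ e0, ∀ e, e0 ≤ e →
    Ie p (Ideal.span {g ^ (a * ∑ i ∈ Finset.range e, (p ^ β) ^ i)}) (β * e) =
    Ie p (Ideal.span {g ^ (a * ∑ i ∈ Finset.range e0, (p ^ β) ^ i)}) (β * e0) := by
  simp only [Ie_iterate p s hs hd]
  refine gabber (p ^ β) ?_ _ ?_ ?_
  · calc 2 ≤ p := (Fact.out : p.Prime).two_le
      _ ≤ p ^ β := Nat.le_self_pow (by omega) p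
  · intro J K h
    exact Ie_mono p s hs hd β (Ideal.mul_mono_right h)
  · intro r J K h x hx
    refine mem_col.1 (SetLike.le_def.1 ((Ie_le_iff p s hs hd β _ _).2 ?_) hx)
    rw [Ideal.span_singleton_mul_le_iff]
    intro y hy
    refine col_frI p s hs hd β _ _ _ ?_
    refine condStar p s hs hd β (Ideal.span {g ^ a} * K) ?_
    have : r ^ p ^ β * (g ^ a * y) = g ^ a * (r ^ p ^ β * y) := by ring
    rw [this]
    exact Ideal.mul_mem_mul (Ideal.mem_span_singleton_self _) (h y hy)

theorem tau_eq (s : Finset R) (hs : maximalIdeal R = Ideal.span (s : Set R))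
    (hd : (s.card : WithBot ℕ∞) ≤ ringKrullDim R)
    (g : R) (m e : ℕ) (he : 1 ≤ e) :
    tau p (Ideal.span {g}) ((m : ℝ) / (p : ℝ) ^ e) = Ie p (Ideal.span {g ^ m}) e := by
  have hp0 : (0 : ℝ) < p := by exact_mod_cast (Fact.out : p.Prime).pos
  apply le_antisymm
  · refine iSup_le ?_
    rintro ⟨e', he'⟩
    simp only
    set n := ⌈(m : ℝ) / (p : ℝ) ^ e * (p : ℝ) ^ e'⌉₊ with hn
    have hle : m * p ^ e' ≤ n * p ^ e := by
      have h1 : (m : ℝ) / (p : ℝ) ^ e * (p : ℝ) ^ e' ≤ n := Nat.le_ceil _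
      have h2 : (m : ℝ) * (p : ℝ) ^ e' ≤ n * (p : ℝ) ^ e := by
        rw [div_mul_eq_mul_div, div_le_iff₀ (by positivity)] at h1
        exact h1
      exact_mod_cast h2
    rw [Ideal.span_singleton_pow, Ie_le_iff p s hs hd, Ideal.span_singleton_le_iff_mem]
    set I0 := Ie p (Ideal.span {g ^ m}) e
    have hm : g ^ m ∈ frI p e I0 :=
      condStar p s hs hd e (Ideal.span {g ^ m}) (Ideal.mem_span_singleton_self _)
    have hpp : ∀ k, 0 < p ^ k := fun k => pow_pos (Fact.out : p.Prime).pos k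
    rcases le_total e' e with h | h
    · obtain ⟨f, rfl⟩ := Nat.exists_eq_add_of_le' h
      rw [frI_add] at hm
      rw [← pow_mem_frI_iff p s hs hd f, ← pow_mul]
      refine Ideal.mem_of_dvd _ (pow_dvd_pow g ?_) hm
      rw [pow_add, ← mul_assoc] at hle
      exact Nat.le_of_mul_le_mul_right hle (hpp e')
    · obtain ⟨f, rfl⟩ := Nat.exists_eq_add_of_le' h
      rw [frI_add]
      have h2 := pow_mem_frI p f hm
      rw [← pow_mul] at h2
      refine Ideal.mem_of_dvd _ (pow_dvd_pow g ?_) h2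
      rw [pow_add, ← mul_assoc] at hle
      exact Nat.le_of_mul_le_mul_right hle (hpp e)
  · have h1 := le_iSup (fun e' : {e : ℕ // 1 ≤ e} => Ie p ((Ideal.span {g}) ^
      ⌈(m : ℝ) / (p : ℝ) ^ e * (p : ℝ) ^ (e' : ℕ)⌉₊) (e' : ℕ)) ⟨e, he⟩
    simp only at h1
    rw [div_mul_cancel₀ _ (by positivity), Nat.ceil_natCast, Ideal.span_singleton_pow] at h1
    exact h1

theorem tau_anti (s : Finset R) (hs : maximalIdeal R = Ideal.span (s : Set R))
    (hd : (s.card : WithBot ℕ∞) ≤ ringKrullDim R)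
    (g : R) {c d : ℝ} (h : c ≤ d) :
    tau p (Ideal.span {g}) d ≤ tau p (Ideal.span {g}) c := by
  refine iSup_mono fun e => Ie_mono p s hs hd _ (Ideal.pow_le_pow_right (Nat.ceil_mono ?_))
  gcongr

end Main2

/-- With `γ = a/(p^β - 1)`, there exists `c ∈ (0, γ)` such that `τ(g^d) = τ(g^c)` for all
`d ∈ (c, γ)`. -/
theorem stmt11 {R : Type*} [CommRing R] [IsNoetherianRing R] [IsLocalRing R]
    [IsAdicComplete (IsLocalRing.maximalIdeal R) R]
    (p : ℕ) (hp : p.Prime) [CharP R p]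
    (hreg : IsRegularStmt R) (g : R) (a β : ℕ) (ha : 1 ≤ a) (hβ : 1 ≤ β) :
    ∃ c : ℝ, 0 < c ∧ c < (a : ℝ) / ((p : ℝ) ^ β - 1) ∧
      ∀ d : ℝ, c < d → d < (a : ℝ) / ((p : ℝ) ^ β - 1) →
        tau p (Ideal.span {g}) d = tau p (Ideal.span {g}) c := by
  have : Fact p.Prime := ⟨hp⟩
  obtain ⟨s, hs, hcard⟩ := hreg
  have hd : (s.card : WithBot ℕ∞) ≤ ringKrullDim R := le_of_eq hcard
  obtain ⟨e0, he0⟩ := stab p s hs hd g a β hβ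
  set q : ℝ := (p : ℝ) ^ β with hq
  have hp1 : (1 : ℝ) < p := by exact_mod_cast hp.one_lt
  have hq1 : 1 < q := one_lt_pow₀ hp1 (by omega)
  have hq1' : 0 < q - 1 := by linarith
  set γ : ℝ := (a : ℝ) / (q - 1) with hγ
  have ha0 : (0 : ℝ) < a := by exact_mod_cast ha
  have hγ0 : 0 < γ := div_pos ha0 hq1'
  let N : ℕ → ℕ := fun e => a * ∑ i ∈ Finset.range e, (p ^ β) ^ i
  let cc : ℕ → ℝ := fun e => (N e : ℝ) / (p : ℝ) ^ (β * e)
  have hcc : ∀ e, cc e = γ * (1 - (q⁻¹) ^ e) := by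
    intro e
    have h1 : (N e : ℝ) = γ * (q ^ e - 1) := by
      have h2 := geom_sum_mul q e
      have h3 : (N e : ℝ) = a * ∑ i ∈ Finset.range e, q ^ i := by
        simp only [N]; push_cast; rfl
      rw [h3, ← h2, hγ]
      field_simp
    simp only [cc]
    rw [h1, pow_mul, ← hq, inv_pow]
    have : q ^ e ≠ 0 := by positivity
    field_simp
  have hinv0 : 0 < q⁻¹ := by positivity
  have hinv1 : q⁻¹ < 1 := inv_lt_one_of_one_lt₀ hq1
  have hlt : ∀ e, cc e < γ := by
    intro e
    rw [hcc]
    have : 0 < (q⁻¹) ^ e := by positivity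
    nlinarith
  have htau : ∀ e, 1 ≤ e → tau p (Ideal.span {g}) (cc e) = Ie p (Ideal.span {g ^ N e}) (β * e) :=
    fun e he => tau_eq p s hs hd g (N e) (β * e) (Nat.mul_pos hβ he)
  refine ⟨cc (e0 + 1), ?_, hlt _, fun d hcd hdγ => ?_⟩
  · rw [hcc]
    have : (q⁻¹) ^ (e0 + 1) < 1 := pow_lt_one₀ hinv0.le hinv1 (by omega)
    exact mul_pos hγ0 (by linarith)
  · refine le_antisymm (tau_anti p s hs hd g hcd.le) ?_
    obtain ⟨n, hn⟩ := exists_pow_lt_of_lt_one (show 0 < (γ - d) / γ from div_pos (by linarith) hγ0) hinv1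
    have hde : d ≤ cc (n + (e0 + 1)) := by
      rw [hcc]
      have h1 : (q⁻¹) ^ (n + (e0 + 1)) ≤ (q⁻¹) ^ n :=
        pow_le_pow_of_le_one hinv0.le hinv1.le (by omega)
      have h2 := h1.trans_lt hn
      rw [lt_div_iff₀ hγ0] at h2
      linarith
    refine le_trans (le_of_eq ?_) (tau_anti p s hs hd g hde)
    rw [htau _ (by omega), htau _ (by omega)]
    exact (he0 _ (by omega)).trans (he0 _ (by omega)).symm
end
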